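/- arXiv:1008.1744 — 5 statements merged into one kernel-verified Lean document; each statement's English description precedes it below -/
import Mathlib

section
/- Let r ≥ 1 and let μ be a Borel probability measure whose support is a compact interval, absolutely continuous with respect to Lebesgue measure with density f, and assume i(f) = ess inf_{supp μ} f > 0. Then for every α < 0 (including α = −∞) and every R ≥ 0, e^{rR}·D^α_μ(R) ≤ 2^r / i(f)^r. -/
open MeasureTheory Filter Set
open scoped ENNReal Topology Classical

noncomputable section

/-- A scalar quantizer: a Borel measurable map `ℝ → ℝ` with countable range. -/
def IsQuantizer (q : ℝ → ℝ) : Prop :=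
  Measurable q ∧ (Set.range q).Countable

/-- The Rényi entropy of order `α ∈ [-∞,∞]` of the quantizer `q` with respect to `μ`. -/
def renyiEntropy (α : EReal) (μ : Measure ℝ) (q : ℝ → ℝ) : EReal :=
  if α = ⊤ then
    - ENNReal.log (⨆ a : ℝ, μ (q ⁻¹' {a}))
  else if α = ⊥ then
    - ENNReal.log (⨅ a ∈ {a : ℝ | 0 < μ (q ⁻¹' {a})}, μ (q ⁻¹' {a}))
  else if α = 1 then
    ((∑' a : ℝ, ENNReal.ofReal (-((μ (q ⁻¹' {a})).toReal * Real.log (μ (q ⁻¹' {a})).toReal)) : ℝ≥0∞) : EReal)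
  else
    (((1 - α.toReal)⁻¹ : ℝ) : EReal) *
      ENNReal.log (∑' a : ℝ, if 0 < μ (q ⁻¹' {a}) then μ (q ⁻¹' {a}) ^ α.toReal else 0)

/-- The `r`-th power distortion of the quantizer `q` with respect to `μ`. -/
def distortion (r : ℝ) (μ : Measure ℝ) (q : ℝ → ℝ) : ℝ≥0∞ :=
  ∫⁻ x, ENNReal.ofReal (|x - q x| ^ r) ∂μ

/-- The optimal quantization error under Rényi entropy constraint `R` of order `α`. -/
def optErr (r : ℝ) (α : EReal) (μ : Measure ℝ) (R : ℝ) : ℝ≥0∞ :=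
  ⨅ (q : ℝ → ℝ) (_ : IsQuantizer q ∧ renyiEntropy α μ q ≤ (R : EReal)), distortion r μ q

/-- The (topological) support of a measure on `ℝ`. -/
def msupport (μ : Measure ℝ) : Set ℝ :=
  {x : ℝ | ∀ ε > 0, 0 < μ (Set.Ioo (x - ε) (x + ε))}

/-- The constant `C(r) = 1/((1+r)2^r)`. -/
def Cr (r : ℝ) : ℝ := 1 / ((1 + r) * 2 ^ r)

/-- `a₁ = (1-α+αr)/(1-α+r)`. -/
def a1 (α r : ℝ) : ℝ := (1 - α + α * r) / (1 - α + r)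

/-- `a₂ = (1-α+r)/(1-α)`. -/
def a2 (α r : ℝ) : ℝ := (1 - α + r) / (1 - α)

/-- The class `Q^c`: quantizers with finitely many codecells, each an interval,
with each codepoint in the closure of its codecell. -/
def Qc (q : ℝ → ℝ) : Prop :=
  Measurable q ∧ (Set.range q).Finite ∧
    ∀ a ∈ Set.range q, (q ⁻¹' {a}).OrdConnected ∧ a ∈ closure (q ⁻¹' {a})

/-- The compressor associated with a point density `g`. -/
def compressor (g : ℝ → ℝ) (x : ℝ) : ℝ := ∫ y in Set.Iic x, g y

/-- The generalized inverse of the compressor of `g`, extended to `[0,1]` by the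
endpoints of the support of `g·λ`. -/
def geninv (g : ℝ → ℝ) (y : ℝ) : ℝ :=
  if y ≤ 0 then sInf (msupport (volume.withDensity fun x => ENNReal.ofReal (g x)))
  else if 1 ≤ y then sSup (msupport (volume.withDensity fun x => ENNReal.ofReal (g x)))
  else sSup {x : ℝ | compressor g x ≤ y}

/-- The `N`-level uniform quantizer on `[0,1]`: each cell `((i-1)/N, i/N]`
(the first cell being `[0,1/N]`) is mapped to its midpoint `(2i-1)/(2N)`. -/
def uniformQ (N : ℕ) (x : ℝ) : ℝ :=
  ((2 * max 1 ⌈x * (N : ℝ)⌉ - 1 : ℤ) : ℝ) / (2 * (N : ℝ))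

/-- The `N`-level companding quantizer with point density `g`. -/
def compand (g : ℝ → ℝ) (N : ℕ) (x : ℝ) : ℝ :=
  geninv g (uniformQ N (compressor g x))

/-- The infinite-level uniform quantizer with step `Δ`, mapping `(iΔ,(i+1)Δ]` to `(i+1/2)Δ`. -/
def unifQ (Δ : ℝ) (x : ℝ) : ℝ := (((⌈x / Δ⌉ : ℤ) : ℝ) - 1 / 2) * Δ

/-- The quantizer obtained from `unifQ Δ` by keeping only codecells entirely inside `M`. -/
def unifQres (Δ : ℝ) (M : Set ℝ) (x : ℝ) : ℝ :=
  if unifQ Δ ⁻¹' {unifQ Δ x} ⊆ M then unifQ Δ x else 0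

/-- The Rényi differential entropy of order `α ∈ ℝ` of `μ` with density `f`. -/
def diffEntropyR (α : ℝ) (μ : Measure ℝ) (f : ℝ → ℝ) : ℝ :=
  if α = 1 then -∫ x, f x * Real.log (f x)
  else (1 - α)⁻¹ * Real.log (∫ x in msupport μ, f x ^ α)

/-- The Rényi relative entropy of order `α ∈ [-∞,∞)` between `μ = f·λ` and `ν = g·λ`. -/
def relEntropyR (α : EReal) (μ : Measure ℝ) (f g : ℝ → ℝ) : ℝ :=
  if α = ⊥ then
    Real.log (essInf (fun x => f x / g x)
      (volume.restrict (Set.Ioo (sInf (msupport μ)) (sSup (msupport μ)))))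
  else if α = 1 then ∫ x in {x : ℝ | 0 < f x}, f x * Real.log (f x / g x)
  else (α.toReal - 1)⁻¹ *
    Real.log (∫ x in {x : ℝ | 0 < f x}, f x ^ α.toReal * g x ^ (1 - α.toReal))

open ProbabilityTheory

lemma msupport_eq_support (μ : Measure ℝ) : msupport μ = μ.support := by
  ext x
  rw [(nhds_basis_Ioo_pos x).mem_measureSupport]
  rfl

lemma continuous_cdf_of_nullSingletonClass (μ : Measure ℝ) [IsProbabilityMeasure μ] [NullSingletonClass μ] :
    Continuous (cdf μ) := by
  rw [continuous_iff_continuousAt]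
  intro x
  rw [(monotone_cdf μ).continuousAt_iff_leftLim_eq_rightLim, (cdf μ).rightLim_eq]
  refine le_antisymm ((monotone_cdf μ).leftLim_le le_rfl) ?_
  have h := (cdf μ).measure_singleton x
  rw [measure_cdf, measure_singleton] at h
  linarith [ENNReal.ofReal_eq_zero.1 h.symm]

lemma measure_Ioc_eq_ofReal_cdf (μ : Measure ℝ) [IsProbabilityMeasure μ] (x y : ℝ) :
    μ (Ioc x y) = ENNReal.ofReal (cdf μ y - cdf μ x) := by
  conv_lhs => rw [← measure_cdf μ]
  exact (cdf μ).measure_Ioc x y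

lemma cdf_left_eq_zero {μ : Measure ℝ} [IsProbabilityMeasure μ] [NullSingletonClass μ] {c d : ℝ}
    (h : μ (Icc c d)ᶜ = 0) : cdf μ c = 0 := by
  have hlt : μ (Iio c) = 0 :=
    measure_mono_null (subset_compl_comm.1 fun x hx => notMem_Iio.2 hx.1) h
  rw [cdf_eq_real, measureReal_def, ← Iio_union_right, measure_union_null hlt (measure_singleton c),
    ENNReal.toReal_zero]

lemma cdf_right_eq_one {μ : Measure ℝ} [IsProbabilityMeasure μ] {c d : ℝ}
    (h : μ (Icc c d)ᶜ = 0) : cdf μ d = 1 := by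
  have hlt : μ (Iic d)ᶜ = 0 :=
    measure_mono_null (compl_subset_compl.2 fun x hx => hx.2) h
  rw [cdf_eq_real, measureReal_def, (prob_compl_eq_zero_iff measurableSet_Iic).1 hlt,
    ENNReal.toReal_one]

/-- The Rényi entropy of negative order of a quantizer all of whose non-null cells have the same
mass `1 / N` is at most `log N`. -/
lemma renyiEntropy_le_log_of_equal_cells {μ : Measure ℝ} [IsProbabilityMeasure μ] {q : ℝ → ℝ}
    (hq : Measurable q) {N : ℕ} (hN : 0 < N)
    (hcell : ∀ a, 0 < μ (q ⁻¹' {a}) → μ (q ⁻¹' {a}) = (N : ℝ≥0∞)⁻¹)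
    {α : EReal} (hα : α < 0) : renyiEntropy α μ q ≤ ENNReal.log N := by
  have htop : α ≠ ⊤ := (hα.trans EReal.zero_lt_top).ne
  have hone : α ≠ 1 := (hα.trans zero_lt_one).ne
  have hN0 : (N : ℝ≥0∞) ≠ 0 := by exact_mod_cast hN.ne'
  rw [renyiEntropy, if_neg htop]
  split_ifs with hbot
  · rw [EReal.neg_le, ← ENNReal.log_inv]
    exact ENNReal.log_le_log (le_iInf₂ fun a ha => (hcell a ha).ge)
  · lift α to ℝ using ⟨htop, hbot⟩
    have hα' : α < 0 := by exact_mod_cast hα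
    rw [EReal.toReal_coe]
    have hterm (a : ℝ) : (if 0 < μ (q ⁻¹' {a}) then μ (q ⁻¹' {a}) ^ α else 0) ≤
        (N : ℝ≥0∞) ^ (1 - α) * μ (q ⁻¹' {a}) := by
      split_ifs with ha
      · rw [hcell a ha, ENNReal.inv_rpow, ← ENNReal.rpow_neg, ← ENNReal.rpow_neg_one,
          ← ENNReal.rpow_add _ _ hN0 (ENNReal.natCast_ne_top N)]
        exact le_of_eq (by congr 1; ring)
      · exact zero_le
    have hmass : ∑' a : ℝ, μ (q ⁻¹' {a}) ≤ 1 :=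
      (tsum_meas_le_meas_iUnion_of_disjoint μ (fun a => hq (measurableSet_singleton a))
        (fun a b hab => Disjoint.preimage q (by simpa using hab))).trans prob_le_one
    have hsum : (∑' a : ℝ, if 0 < μ (q ⁻¹' {a}) then μ (q ⁻¹' {a}) ^ α else 0) ≤
        (N : ℝ≥0∞) ^ (1 - α) := by
      refine (ENNReal.tsum_le_tsum hterm).trans ?_
      rw [ENNReal.tsum_mul_left]
      exact mul_le_of_le_one_right' hmass
    have hpos : 0 < 1 - α := by linarith
    calc _ ≤ (((1 - α)⁻¹ : ℝ) : EReal) * ENNReal.log ((N : ℝ≥0∞) ^ (1 - α)) :=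
          mul_le_mul_of_nonneg_left (ENNReal.log_le_log hsum)
            (by exact_mod_cast (inv_pos.2 hpos).le)
      _ = ENNReal.log N := by
          rw [ENNReal.log_rpow, ← mul_assoc, ← EReal.coe_mul, inv_mul_cancel₀ hpos.ne',
            EReal.coe_one, one_mul]

/-- If the distribution function grows at rate at least `m` on `[c, d]`, then there is a quantizer
whose non-null cells all have mass `1 / N` and which moves no point of `[c, d]` by more than
`1 / (N * m)`. -/
lemma exists_equal_cells_quantizer {μ : Measure ℝ} [IsProbabilityMeasure μ] [NullSingletonClass μ]
    {c d m : ℝ} (hcd : c ≤ d) (hm : 0 < m) (hnull : μ (Icc c d)ᶜ = 0)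
    (hgrow : ∀ x ∈ Icc c d, ∀ y ∈ Icc c d, x ≤ y → m * (y - x) ≤ cdf μ y - cdf μ x)
    {N : ℕ} (hN : 0 < N) :
    ∃ q : ℝ → ℝ, IsQuantizer q ∧
      (∀ a, 0 < μ (q ⁻¹' {a}) → μ (q ⁻¹' {a}) = (N : ℝ≥0∞)⁻¹) ∧
      ∀ x ∈ Icc c d, |x - q x| ≤ 1 / (N * m) := by
  have hN' : (0 : ℝ) < N := by exact_mod_cast hN
  have hsurj : ∀ y ∈ Icc (0 : ℝ) 1, ∃ x ∈ Icc c d, cdf μ x = y := by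
    have := intermediate_value_Icc hcd (continuous_cdf_of_nullSingletonClass μ).continuousOn
    rwa [cdf_left_eq_zero hnull, cdf_right_eq_one hnull] at this
  choose! g hgmem hg using hsurj
  have hstrict : StrictMonoOn (cdf μ) (Icc c d) := fun x hx y hy hxy => by
    nlinarith [hgrow x hx y hy hxy.le, mul_pos hm (sub_pos.2 hxy)]
  let k : ℝ → ℤ := fun x => ⌈N * cdf μ x⌉
  have hkN (x : ℝ) : ((k x : ℝ) / N) ∈ Icc (0 : ℝ) 1 := by
    have h0 : 0 ≤ k x := Int.ceil_nonneg (mul_nonneg hN'.le (cdf_nonneg μ x))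
    have h1 : k x ≤ N := Int.ceil_le.2 (by
      simpa using mul_le_of_le_one_right hN'.le (cdf_le_one μ x))
    exact ⟨div_nonneg (by exact_mod_cast h0) hN'.le, (div_le_one hN').2 (by exact_mod_cast h1)⟩
  have hkmeas : Measurable k :=
    (measurable_const.mul (monotone_cdf μ).measurable).ceil
  refine ⟨fun x => g (k x / N), ⟨?_, ?_⟩, ?_, ?_⟩
  · exact (measurable_from_top (f := fun j : ℤ => g (j / N))).comp hkmeas
  · exact (countable_range fun j : ℤ => g (j / N)).mono
      (range_subset_iff.2 fun x => mem_range_self (k x))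
  · intro a ha
    set A := (fun x => g (k x / N)) ⁻¹' {a} with hA
    have hAeq : μ A = μ (A ∩ Icc c d) := by
      refine le_antisymm ?_ (measure_mono inter_subset_left)
      calc μ A ≤ μ ((A ∩ Icc c d) ∪ (Icc c d)ᶜ) := measure_mono fun x hx => by
            by_cases h : x ∈ Icc c d
            exacts [Or.inl ⟨hx, h⟩, Or.inr h]
        _ ≤ μ (A ∩ Icc c d) + μ (Icc c d)ᶜ := measure_union_le _ _
        _ = _ := by rw [hnull, add_zero]
    have hpos : 0 < μ ((A ∩ Icc c d) \ {c}) := by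
      rw [measure_sdiff_null (measure_singleton c), ← hAeq]
      exact ha
    obtain ⟨x, ⟨hxA, hx⟩, hxc⟩ := nonempty_of_measure_ne_zero hpos.ne'
    have hcx : 0 < cdf μ x := by
      rw [← cdf_left_eq_zero hnull]
      exact hstrict (left_mem_Icc.2 hcd) hx (lt_of_le_of_ne hx.1 (Ne.symm hxc))
    have hk : 1 ≤ k x := Int.ceil_pos.2 (mul_pos hN' hcx)
    have hk' : (1 : ℝ) ≤ k x := by exact_mod_cast hk
    have hprev : ((k x : ℝ) - 1) / N ∈ Icc (0 : ℝ) 1 :=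
      ⟨div_nonneg (by linarith) hN'.le,
        (div_le_div_of_nonneg_right (by linarith) hN'.le).trans (hkN x).2⟩
    have hcell : A ∩ Icc c d = Ioc (g (((k x : ℝ) - 1) / N)) (g (k x / N)) := by
      have hiff (y : ℝ) (hy : y ∈ Icc c d) :
          y ∈ A ↔ y ∈ Ioc (g (((k x : ℝ) - 1) / N)) (g (k x / N)) := by
        have hkk : y ∈ A ↔ k y = k x := by
          rw [hA, mem_preimage, mem_singleton_iff, ← mem_singleton_iff.1 (mem_preimage.1 hxA)]
          refine ⟨fun h => ?_, fun h => by rw [h]⟩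
          have := congrArg (cdf μ) h
          rw [hg _ (hkN y), hg _ (hkN x), div_left_inj' hN'.ne'] at this
          exact_mod_cast this
        rw [hkk, mem_Ioc, ← hstrict.lt_iff_lt (hgmem _ hprev) hy,
          ← hstrict.le_iff_le hy (hgmem _ (hkN x)), hg _ hprev, hg _ (hkN x), Int.ceil_eq_iff,
          div_lt_iff₀' hN', le_div_iff₀' hN']
      ext y
      refine ⟨fun h => (hiff y h.2).1 h.1, fun h => ?_⟩
      have hy : y ∈ Icc c d := ⟨(hgmem _ hprev).1.trans h.1.le, h.2.trans (hgmem _ (hkN x)).2⟩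
      exact ⟨(hiff y hy).2 h, hy⟩
    rw [hAeq, hcell, measure_Ioc_eq_ofReal_cdf, hg _ hprev, hg _ (hkN x), ← sub_div,
      sub_sub_cancel, one_div, ENNReal.ofReal_inv_of_pos hN', ENNReal.ofReal_natCast]
  · intro x hx
    have hq := hgmem _ (hkN x)
    have hle : N * cdf μ x ≤ k x := Int.le_ceil _
    have hlt : (k x : ℝ) < N * cdf μ x + 1 := Int.ceil_lt_add_one _
    have hxq : cdf μ x ≤ cdf μ (g (k x / N)) := by rwa [hg _ (hkN x), le_div_iff₀' hN']
    have hle' : x ≤ g (k x / N) := (hstrict.le_iff_le hx hq).1 hxq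
    have h1 := hgrow x hx _ hq hle'
    have h2 : cdf μ (g (k x / N)) - cdf μ x ≤ 1 / N := by
      rw [hg _ (hkN x), le_div_iff₀' hN', mul_sub, mul_div_cancel₀ _ hN'.ne']
      linarith
    rw [abs_sub_comm, abs_of_nonneg (sub_nonneg.2 hle'), mul_comm (N : ℝ), ← div_div,
      le_div_iff₀ hN']
    rw [le_div_iff₀ hN'] at h2
    rw [le_div_iff₀ hm]
    nlinarith

lemma mul_sub_le_cdf_sub_of_ae_le {μ : Measure ℝ} [IsProbabilityMeasure μ] {f : ℝ → ℝ}
    (hμ : μ = volume.withDensity fun x => ENNReal.ofReal (f x)) {c d m : ℝ} (hm : 0 ≤ m)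
    (hf : ∀ᵐ x ∂volume.restrict (Icc c d), m ≤ f x) {x y : ℝ} (hx : x ∈ Icc c d)
    (hy : y ∈ Icc c d) (hxy : x ≤ y) : m * (y - x) ≤ cdf μ y - cdf μ x := by
  rw [← ENNReal.ofReal_le_ofReal_iff (sub_nonneg.2 (monotone_cdf μ hxy)),
    ← measure_Ioc_eq_ofReal_cdf, ENNReal.ofReal_mul hm, ← Real.volume_Ioc, ← setLIntegral_const]
  conv_rhs => rw [hμ, withDensity_apply _ measurableSet_Ioc]
  refine lintegral_mono_ae ?_
  have hsub : Ioc x y ⊆ Icc c d := fun z hz => ⟨hx.1.trans hz.1.le, hz.2.trans hy.2⟩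
  filter_upwards [ae_restrict_of_ae_restrict_of_subset hsub hf] with z hz
  exact ENNReal.ofReal_le_ofReal hz

lemma distortion_le_of_forall_abs_sub_le {r : ℝ} (hr : 0 ≤ r) {μ : Measure ℝ}
    [IsProbabilityMeasure μ] {s : Set ℝ} (hs : μ sᶜ = 0) {q : ℝ → ℝ} {δ : ℝ}
    (h : ∀ x ∈ s, |x - q x| ≤ δ) : distortion r μ q ≤ ENNReal.ofReal (δ ^ r) := by
  calc distortion r μ q ≤ ∫⁻ _, ENNReal.ofReal (δ ^ r) ∂μ := by
        refine lintegral_mono_ae ?_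
        filter_upwards [mem_ae_iff.2 hs] with x hx
        exact ENNReal.ofReal_le_ofReal (Real.rpow_le_rpow (abs_nonneg _) (h x hx) hr)
    _ = _ := by rw [lintegral_const, measure_univ, mul_one]

/-- upper bound on the optimal error for negative orders. -/
theorem statement10
    (r : ℝ) (hr : 1 ≤ r)
    (μ : Measure ℝ) [IsProbabilityMeasure μ]
    (c d : ℝ) (hcd : c ≤ d) (hsupp : msupport μ = Set.Icc c d)
    (f : ℝ → ℝ) (hf_meas : Measurable f) (hf_nonneg : 0 ≤ f)
    (hμ : μ = volume.withDensity fun x => ENNReal.ofReal (f x))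
    (hinf : 0 < essInf f (volume.restrict (msupport μ))) :
    ∀ α : EReal, α < 0 → ∀ R : ℝ, 0 ≤ R →
      ENNReal.ofReal (Real.exp (r * R)) * optErr r α μ R ≤
        ENNReal.ofReal (2 ^ r / essInf f (volume.restrict (msupport μ)) ^ r) := by
  intro α hα R hR
  set m := essInf f (volume.restrict (msupport μ)) with hmdef
  have hr0 : 0 ≤ r := zero_le_one.trans hr
  have hfm : ∀ᵐ x ∂volume.restrict (Icc c d), m ≤ f x := by
    rw [hmdef, hsupp]
    exact ae_essInf_le (isBoundedUnder_of ⟨0, hf_nonneg⟩)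
  have hnull : μ (Icc c d)ᶜ = 0 := by
    rw [← hsupp, msupport_eq_support]
    exact Measure.measure_compl_support
  have : NullSingletonClass μ := ⟨fun x => by
    rw [hμ]
    exact withDensity_absolutelyContinuous _ _ (measure_singleton x)⟩
  set N := ⌊Real.exp R⌋₊
  have hN : 0 < N := Nat.floor_pos.2 (Real.one_le_exp hR)
  have hN1 : (1 : ℝ) ≤ N := by exact_mod_cast hN
  obtain ⟨q, hq, hcell, hdist⟩ := exists_equal_cells_quantizer hcd hinf hnull
    (fun x hx y hy => mul_sub_le_cdf_sub_of_ae_le hμ hinf.le hfm hx hy) hN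
  have hent : renyiEntropy α μ q ≤ (R : EReal) := by
    refine (renyiEntropy_le_log_of_equal_cells hq.1 hN hcell hα).trans ?_
    rw [← Real.log_exp R, ← ENNReal.log_ofReal_of_pos (Real.exp_pos R), ← ENNReal.ofReal_natCast]
    exact ENNReal.log_le_log (ENNReal.ofReal_le_ofReal (Nat.floor_le (Real.exp_pos R).le))
  have hopt : optErr r α μ R ≤ ENNReal.ofReal ((1 / (N * m)) ^ r) :=
    (iInf₂_le q ⟨hq, hent⟩).trans (distortion_le_of_forall_abs_sub_le hr0 hnull hdist)
  have hexp : Real.exp R ≤ 2 * N := by linarith [Nat.lt_floor_add_one (Real.exp R)]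
  have hδ : 0 ≤ 1 / (N * m) := by positivity
  refine (mul_le_mul_right hopt _).trans ?_
  rw [← ENNReal.ofReal_mul (Real.exp_pos _).le, mul_comm r R, Real.exp_mul,
    ← Real.mul_rpow (Real.exp_pos R).le hδ, ← Real.div_rpow zero_le_two hinf.le]
  refine ENNReal.ofReal_le_ofReal (Real.rpow_le_rpow (by positivity) ?_ hr0)
  rw [mul_one_div, div_le_div_iff₀ (by positivity) hinf]
  nlinarith

end
end

section
/- Let r ≥ 1 and let μ be a Borel probability measure whose support is a compact interval, absolutely continuous with respect to Lebesgue measure with density f satisfying 0 < i(f) ≤ s(f) < ∞. Set C = (i(f)/s(f))^{(r+1)/r}·(1/(4^r(1+r)))^{1/r} and, for R ≥ 0, let H_R = { q ∈ Q^c : H^α_μ(q) ≤ R and C·e^R ≤ card(N_q) ≤ e^R }, where N_q = { a ∈ q(ℝ) : μ(q⁻¹(a)) > 0 }. Then for every α ∈ [−∞, 0] and R ≥ 0, D^α_μ(R) = inf{ D_μ(q) : q ∈ H_R }. Moreover, for α ∈ (−∞, 0), κ > 0 and R > log((2^{1−α}−1)/κ), define K_R(κ) = { q ∈ H_R : e^{R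 − H^α_μ(q)} ≤ (1/(1 − (2^{1−α}−1)·κ^{−1}·e^{−R}))^{1/(1−α)} }; then for every α ∈ (−∞, 0) and R > log((2^{1−α}−1)/C), D^α_μ(R) = inf{ D_μ(q) : q ∈ K_R(C) }. -/
open MeasureTheory Filter Set
open scoped ENNReal Topology Classical

noncomputable section

/-- The distribution of `q` under `μ`: the codepoints of positive mass are the distinct reals
`a 0, …, a (n - 1)`, with masses `p 0, …, p (n - 1)`. -/
structure HasMasses (μ : Measure ℝ) (q : ℝ → ℝ) (n : ℕ) (a p : ℕ → ℝ) : Prop where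
  quant : IsQuantizer q
  inj : ∀ i < n, ∀ j < n, a i = a j → i = j
  pos : ∀ i < n, 0 < p i
  mass : ∀ i < n, μ (q ⁻¹' {a i}) = ENNReal.ofReal (p i)
  null : ∀ x, (∀ i < n, a i ≠ x) → μ (q ⁻¹' {x}) = 0

/-- `μ` is a probability measure on `[c, d]` with density between `m` and `M`. -/
structure BddDensity (μ : Measure ℝ) (c d m M : ℝ) : Prop where
  lt : c < d
  pos : 0 < m
  le : m ≤ M
  one_le : 1 ≤ M * (d - c)
  compl_null : μ (Icc c d)ᶜ = 0
  lower : ENNReal.ofReal m • volume.restrict (Icc c d) ≤ μ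
  upper : μ ≤ ENNReal.ofReal M • volume

namespace HasMasses

variable {μ : Measure ℝ} {q : ℝ → ℝ} {n : ℕ} {a p : ℕ → ℝ}

lemma meas (h : HasMasses μ q n a p) (x : ℝ) : MeasurableSet (q ⁻¹' {x}) :=
  h.quant.1 (measurableSet_singleton x)

lemma ae_mem (h : HasMasses μ q n a p) : ∀ᵐ x ∂μ, ∃ i < n, q x = a i := by
  have hsub : {x | ¬ ∃ i < n, q x = a i} ⊆
      ⋃ y ∈ {y ∈ Set.range q | ∀ i < n, a i ≠ y}, q ⁻¹' {y} := by
    intro x hx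
    simp only [mem_ofPred_eq, not_exists, not_and] at hx
    simp only [mem_ofPred_eq, mem_iUnion, mem_preimage, mem_singleton_iff, exists_prop]
    exact ⟨q x, ⟨⟨x, rfl⟩, fun i hi h => hx i hi h.symm⟩, rfl⟩
  refine measure_mono_null hsub ?_
  refine (measure_biUnion_null_iff (h.quant.2.mono (fun y hy => hy.1))).2 ?_
  intro y hy
  exact h.null y hy.2

lemma sum_mass (h : HasMasses μ q n a p) [IsProbabilityMeasure μ] :
    ∑ i ∈ Finset.range n, p i = 1 := by
  have h1 : μ (⋃ i ∈ Finset.range n, q ⁻¹' {a i}) = ∑ i ∈ Finset.range n, μ (q ⁻¹' {a i}) := by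
    refine measure_biUnion_finset ?_ fun i _ => h.meas _
    intro i hi j hj hij
    refine Set.disjoint_left.2 fun x hx hx' => hij ?_
    simp only [mem_preimage, mem_singleton_iff] at hx hx'
    exact h.inj i (by simpa using hi) j (by simpa using hj) (hx ▸ hx')
  have h2 : μ (⋃ i ∈ Finset.range n, q ⁻¹' {a i}) = 1 := by
    rw [← prob_compl_eq_zero_iff (Finset.measurableSet_biUnion _ fun i _ => h.meas _)]
    refine measure_mono_null ?_ (ae_iff.1 h.ae_mem)
    intro x hx
    simpa using hx
  rw [h2, Finset.sum_congr rfl fun i hi => h.mass i (Finset.mem_range.1 hi),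
    ← ENNReal.ofReal_sum_of_nonneg fun i hi => (h.pos i (Finset.mem_range.1 hi)).le] at h1
  have := congrArg ENNReal.toReal h1
  rw [ENNReal.toReal_ofReal (Finset.sum_nonneg fun i hi => (h.pos i (Finset.mem_range.1 hi)).le)]
    at this
  simpa using this.symm

lemma card_pos (h : HasMasses μ q n a p) [IsProbabilityMeasure μ] : 0 < n := by
  rcases Nat.eq_zero_or_pos n with rfl | h0
  · simpa using h.sum_mass
  · exact h0

lemma pos_iff (h : HasMasses μ q n a p) (x : ℝ) : 0 < μ (q ⁻¹' {x}) ↔ ∃ i < n, a i = x := by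
  constructor
  · intro hx
    by_contra! hc
    exact hx.ne' (h.null x hc)
  · rintro ⟨i, hi, rfl⟩
    rw [h.mass i hi]
    exact ENNReal.ofReal_pos.2 (h.pos i hi)

lemma ncard_eq (h : HasMasses μ q n a p) :
    {x : ℝ | x ∈ Set.range q ∧ 0 < μ (q ⁻¹' {x})}.ncard = n := by
  have : {x : ℝ | x ∈ Set.range q ∧ 0 < μ (q ⁻¹' {x})} = ((Finset.range n).image a : Finset ℝ) := by
    ext x
    simp only [mem_ofPred_eq, h.pos_iff, Finset.coe_image, Set.mem_image, Finset.coe_range, mem_Iio]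
    refine ⟨fun hx => hx.2, fun hx => ⟨?_, hx⟩⟩
    have := (h.pos_iff x).2 hx
    by_contra hc
    rw [Set.preimage_singleton_eq_empty.2 hc] at this
    simp at this
  rw [this, Set.ncard_coe_finset, Finset.card_image_of_injOn, Finset.card_range]
  intro i hi j hj hij
  exact h.inj i (by simpa using hi) j (by simpa using hj) hij

lemma sum_rpow_pos (h : HasMasses μ q n a p) [IsProbabilityMeasure μ] (α : ℝ) :
    0 < ∑ i ∈ Finset.range n, p i ^ α :=
  Finset.sum_pos (fun i hi => Real.rpow_pos_of_pos (h.pos i (Finset.mem_range.1 hi)) _)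
    (Finset.nonempty_range_iff.2 h.card_pos.ne')

lemma renyi_coe (h : HasMasses μ q n a p) [IsProbabilityMeasure μ] {α : ℝ} (hα : α ≤ 0) :
    renyiEntropy α μ q =
      (((1 - α)⁻¹ * Real.log (∑ i ∈ Finset.range n, p i ^ α) : ℝ) : EReal) := by
  have hα1 : (α : EReal) ≠ 1 := by
    intro h1
    have : α = 1 := by exact_mod_cast h1
    linarith
  have hs : (∑' x : ℝ, if 0 < μ (q ⁻¹' {x}) then μ (q ⁻¹' {x}) ^ α else 0) =
      ENNReal.ofReal (∑ i ∈ Finset.range n, p i ^ α) := by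
    rw [tsum_eq_sum (s := (Finset.range n).image a), Finset.sum_image,
      ENNReal.ofReal_sum_of_nonneg]
    · refine Finset.sum_congr rfl fun i hi => ?_
      have hi := Finset.mem_range.1 hi
      rw [if_pos ((h.pos_iff _).2 ⟨i, hi, rfl⟩), h.mass i hi,
        ENNReal.ofReal_rpow_of_pos (h.pos i hi)]
    · exact fun i hi => (Real.rpow_pos_of_pos (h.pos i (Finset.mem_range.1 hi)) _).le
    · intro i hi j hj hij
      exact h.inj i (by simpa using hi) j (by simpa using hj) hij
    · intro x hx
      rw [if_neg]
      rw [h.pos_iff]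
      simpa using hx
  rw [renyiEntropy, if_neg (EReal.coe_ne_top _), if_neg (EReal.coe_ne_bot _), if_neg hα1,
    EReal.toReal_coe, hs, ENNReal.log_ofReal_of_pos (h.sum_rpow_pos α), EReal.coe_mul]

lemma renyi_bot (h : HasMasses μ q n a p) :
    renyiEntropy ⊥ μ q = - ENNReal.log (⨅ i, ⨅ (_ : i < n), ENNReal.ofReal (p i)) := by
  rw [renyiEntropy, if_neg bot_ne_top, if_pos rfl]
  congr 2
  apply le_antisymm
  · refine le_iInf₂ fun i hi => ?_
    rw [← h.mass i hi]
    exact iInf₂_le (f := fun x (_ : x ∈ {x : ℝ | 0 < μ (q ⁻¹' {x})}) => μ (q ⁻¹' {x})) (a i)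
      ((h.pos_iff _).2 ⟨i, hi, rfl⟩)
  · refine le_iInf₂ fun x hx => ?_
    obtain ⟨i, hi, rfl⟩ := (h.pos_iff x).1 hx
    rw [h.mass i hi]
    exact iInf₂_le i hi

/-- For `α ≤ 0` the entropy only depends on the masses. -/
lemma renyi_congr {q' : ℝ → ℝ} {a' : ℕ → ℝ} (h : HasMasses μ q n a p)
    (h' : HasMasses μ q' n a' p) [IsProbabilityMeasure μ] {α : EReal} (hα : α ≤ 0) :
    renyiEntropy α μ q = renyiEntropy α μ q' := by
  induction α with
  | bot => rw [h.renyi_bot, h'.renyi_bot]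
  | coe α =>
    have : α ≤ 0 := by exact_mod_cast hα
    rw [h.renyi_coe this, h'.renyi_coe this]
  | top => simp at hα

end HasMasses

lemma exists_hasMasses_of_finite {μ : Measure ℝ} [IsProbabilityMeasure μ] {q : ℝ → ℝ}
    (hq : IsQuantizer q) (hfin : {x | 0 < μ (q ⁻¹' {x})}.Finite) :
    ∃ n a p, HasMasses μ q n a p ∧ ∀ i j, i < j → j < n → a i < a j := by
  set S := hfin.toFinset with hS
  have hmem : ∀ x, x ∈ S ↔ 0 < μ (q ⁻¹' {x}) := by simp [hS]
  let e := S.orderEmbOfFin rfl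
  let a : ℕ → ℝ := fun k => if h : k < S.card then e ⟨k, h⟩ else 0
  have ha : ∀ k (h : k < S.card), a k = e ⟨k, h⟩ := fun k h => dif_pos h
  have hlt : ∀ i j, i < j → j < S.card → a i < a j := by
    intro i j hij hj
    rw [ha i (hij.trans hj), ha j hj]
    exact e.strictMono hij
  have hpos : ∀ k < S.card, 0 < μ (q ⁻¹' {a k}) := by
    intro k hk
    rw [← hmem, ha k hk]
    exact Finset.orderEmbOfFin_mem _ _ _
  refine ⟨S.card, a, fun k => μ.real (q ⁻¹' {a k}), ⟨hq, ?_, ?_, ?_, ?_⟩, hlt⟩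
  · intro i hi j hj hij
    rcases lt_trichotomy i j with h | h | h
    · exact absurd hij (hlt i j h hj).ne
    · exact h
    · exact absurd hij (hlt j i h hi).ne'
  · intro i hi
    exact ENNReal.toReal_pos (hpos i hi).ne' (measure_ne_top _ _)
  · intro i hi
    simp [Measure.real]
  · intro x hx
    by_contra hc
    have hxS : x ∈ S := (hmem x).2 (pos_iff_ne_zero.2 hc)
    have : x ∈ Set.range e := by
      rw [Finset.range_orderEmbOfFin]
      exact hxS
    obtain ⟨⟨k, hk⟩, hkx⟩ := this
    exact hx k hk (by rw [ha k hk, hkx])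

/-- A finite entropy of order `α ≤ 0` forces finitely many codecells of positive mass. -/
lemma finite_of_renyi_le {μ : Measure ℝ} [IsProbabilityMeasure μ] {q : ℝ → ℝ}
    {α : EReal} (hα : α ≤ 0) {R : ℝ} (hR : renyiEntropy α μ q ≤ R) (hq : IsQuantizer q) :
    {x | 0 < μ (q ⁻¹' {x})}.Finite := by
  induction α with
  | bot =>
    rw [renyiEntropy, if_neg bot_ne_top, if_pos rfl] at hR
    have h1 : (⨅ a ∈ {a : ℝ | 0 < μ (q ⁻¹' {a})}, μ (q ⁻¹' {a})) ≠ 0 := by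
      intro h0
      rw [h0] at hR
      simp at hR
    have h2 : ∑' x : ℝ, μ (q ⁻¹' {x}) ≠ ⊤ := by
      refine ne_top_of_le_ne_top (measure_ne_top μ Set.univ)
        (tsum_meas_le_meas_iUnion_of_disjoint μ (fun x => hq.1 (measurableSet_singleton x)) ?_ |>.trans
          (measure_mono (Set.subset_univ _)))
      intro x y hxy
      refine Set.disjoint_left.2 fun z hz hz' => hxy ?_
      simp only [mem_preimage, mem_singleton_iff] at hz hz'
      exact hz.symm.trans hz'
    refine (ENNReal.finite_const_le_of_tsum_ne_top h2 h1).subset fun x hx => ?_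
    exact iInf₂_le (f := fun y (_ : y ∈ {y : ℝ | 0 < μ (q ⁻¹' {y})}) => μ (q ⁻¹' {y})) x hx
  | coe α =>
    have hα' : α ≤ 0 := by exact_mod_cast hα
    have hα1 : (α : EReal) ≠ 1 := by
      intro h1
      have : α = 1 := by exact_mod_cast h1
      linarith
    rw [renyiEntropy, if_neg (EReal.coe_ne_top _), if_neg (EReal.coe_ne_bot _), if_neg hα1,
      EReal.toReal_coe] at hR
    have h2 : (∑' x : ℝ, if 0 < μ (q ⁻¹' {x}) then μ (q ⁻¹' {x}) ^ α else 0) ≠ ⊤ := by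
      intro ht
      rw [ht, ENNReal.log_top, EReal.coe_mul_top_of_pos (by apply inv_pos.2; linarith)] at hR
      simp at hR
    refine (ENNReal.finite_const_le_of_tsum_ne_top h2 one_ne_zero).subset fun x hx => ?_
    simp only [mem_ofPred_eq] at hx ⊢
    rw [if_pos hx]
    rcases hα'.lt_or_eq with h0 | rfl
    · exact ENNReal.one_le_rpow_of_pos_of_le_one_of_neg hx prob_le_one h0
    · rw [ENNReal.rpow_zero]
  | top => simp at hα

namespace HasMasses

variable {μ : Measure ℝ} {q : ℝ → ℝ} {n : ℕ} {a p : ℕ → ℝ}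

lemma rpow_card_le_sum (h : HasMasses μ q n a p) [IsProbabilityMeasure μ] {α : ℝ} (hα : α ≤ 0) :
    (n : ℝ) ^ (1 - α) ≤ ∑ i ∈ Finset.range n, p i ^ α := by
  have hp : ∀ i ∈ Finset.range n, 0 < p i := fun i hi => h.pos i (Finset.mem_range.1 hi)
  have key := Real.rpow_arith_mean_le_arith_mean_rpow (Finset.range n) p (fun i => (p i)⁻¹)
    (fun i hi => (hp i hi).le) h.sum_mass (fun i hi => (inv_pos.2 (hp i hi)).le)
    (p := 1 - α) (by linarith)
  have h1 : ∑ i ∈ Finset.range n, p i * (p i)⁻¹ = n := by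
    rw [Finset.sum_congr rfl fun i hi => mul_inv_cancel₀ (hp i hi).ne']
    simp
  have h2 : ∀ i ∈ Finset.range n, p i * (p i)⁻¹ ^ (1 - α) = p i ^ α := by
    intro i hi
    rw [Real.inv_rpow (hp i hi).le, ← Real.rpow_neg (hp i hi).le, mul_comm,
      ← Real.rpow_add_one (hp i hi).ne']
    congr 1
    ring
  rwa [h1, Finset.sum_congr rfl h2] at key

lemma card_le_exp (h : HasMasses μ q n a p) [IsProbabilityMeasure μ] {α : EReal} (hα : α ≤ 0)
    {R : ℝ} (hR : renyiEntropy α μ q ≤ R) : (n : ℝ) ≤ Real.exp R := by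
  have hn : (0 : ℝ) < n := by exact_mod_cast h.card_pos
  induction α with
  | bot =>
    rw [h.renyi_bot] at hR
    have hp : ∀ i ∈ Finset.range n, Real.exp (-R) ≤ p i := by
      intro i hi
      have hi := Finset.mem_range.1 hi
      have h1 : -ENNReal.log (ENNReal.ofReal (p i)) ≤ R :=
        le_trans (EReal.neg_le_neg_iff.2 (ENNReal.log_monotone (iInf₂_le i hi))) hR
      rw [ENNReal.log_ofReal_of_pos (h.pos i hi), ← EReal.coe_neg, EReal.coe_le_coe_iff] at h1
      rw [← Real.le_log_iff_exp_le (h.pos i hi)]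
      linarith
    have h2 := Finset.sum_le_sum hp
    rw [h.sum_mass] at h2
    simp only [Finset.sum_const, Finset.card_range, nsmul_eq_mul, Real.exp_neg] at h2
    rwa [← div_eq_mul_inv, div_le_one (Real.exp_pos _)] at h2
  | coe α =>
    have hα' : α ≤ 0 := by exact_mod_cast hα
    rw [h.renyi_coe hα', EReal.coe_le_coe_iff] at hR
    have h1 := Real.log_le_log (Real.rpow_pos_of_pos hn _) (h.rpow_card_le_sum hα')
    rw [Real.log_rpow hn] at h1
    have h3 : (0 : ℝ) < 1 - α := by linarith
    rw [inv_mul_le_iff₀ h3] at hR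
    rw [← Real.log_le_iff_le_exp hn]
    exact le_of_mul_le_mul_left (h1.trans hR) h3
  | top => simp at hα

lemma renyi_uniform_le (h : HasMasses μ q n a fun _ => (n : ℝ)⁻¹) [IsProbabilityMeasure μ]
    {α : EReal} (hα : α ≤ 0) {R : ℝ} (hR : (n : ℝ) ≤ Real.exp R) : renyiEntropy α μ q ≤ R := by
  have hn : (0 : ℝ) < n := by exact_mod_cast h.card_pos
  have hlog : Real.log n ≤ R := (Real.log_le_iff_le_exp hn).2 hR
  induction α with
  | bot =>
    rw [h.renyi_bot]
    have h1 : ENNReal.ofReal (n : ℝ)⁻¹ ≤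
        ⨅ i, ⨅ (_ : i < n), ENNReal.ofReal (n : ℝ)⁻¹ := le_iInf₂ fun _ _ => le_rfl
    refine (EReal.neg_le_neg_iff.2 (ENNReal.log_monotone h1)).trans ?_
    rw [ENNReal.log_ofReal_of_pos (inv_pos.2 hn), ← EReal.coe_neg, EReal.coe_le_coe_iff,
      Real.log_inv]
    linarith
  | coe α =>
    have hα' : α ≤ 0 := by exact_mod_cast hα
    have h3 : (0 : ℝ) < 1 - α := by linarith
    rw [h.renyi_coe hα', EReal.coe_le_coe_iff, inv_mul_le_iff₀ h3]
    have h1 : ∑ i ∈ Finset.range n, ((n : ℝ)⁻¹) ^ α = (n : ℝ) ^ (1 - α) := by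
      rw [Finset.sum_const, Finset.card_range, nsmul_eq_mul, Real.inv_rpow hn.le,
        ← Real.rpow_neg hn.le, mul_comm, ← Real.rpow_add_one hn.ne']
      congr 1
      ring
    rw [h1, Real.log_rpow hn]
    exact mul_le_mul_of_nonneg_left hlog h3.le
  | top => simp at hα

end HasMasses

lemma abs_rpow_le_add {r : ℝ} (hr : 1 ≤ r) (L : ℝ) {ε : ℝ} (hε : 0 < ε) :
    ∃ δ > 0, ∀ y y' : ℝ, |y| ≤ L → |y'| ≤ L → |y - y'| < δ → |y| ^ r ≤ |y'| ^ r + ε := by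
  have hc : ContinuousOn (fun y : ℝ => |y| ^ r) (Icc (-L) L) :=
    (continuous_abs.rpow_const fun _ => Or.inr (by linarith)).continuousOn
  obtain ⟨δ, hδ, h⟩ := Metric.uniformContinuousOn_iff.1
    (isCompact_Icc.uniformContinuousOn_of_continuous hc) ε hε
  refine ⟨δ, hδ, fun y y' hy hy' hyy => ?_⟩
  have := h y (abs_le.1 hy) y' (abs_le.1 hy') (by rwa [Real.dist_eq])
  rw [Real.dist_eq] at this
  linarith [le_abs_self (|y| ^ r - |y'| ^ r)]

/-- A codepoint can be moved into the interior of its interval at an arbitrarily small cost. -/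
lemma exists_interior_codepoint {r : ℝ} (hr : 1 ≤ r) {u v : ℝ} (huv : u < v) (a : ℝ) {ε : ℝ}
    (hε : 0 < ε) : ∃ b ∈ Ioo u v, ∀ x ∈ Icc u v, |x - b| ^ r ≤ |x - a| ^ r + ε := by
  obtain ⟨δ, hδ, h⟩ := abs_rpow_le_add hr (v - u) hε
  set e := max u (min a v) with he
  have heu : u ≤ e := le_max_left _ _
  have hev : e ≤ v := max_le huv.le (min_le_right _ _)
  have hb : ∃ b ∈ Ioo u v, |e - b| < δ := by
    have hcl : e ∈ closure (Ioo u v) := by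
      rw [closure_Ioo huv.ne]
      exact ⟨heu, hev⟩
    obtain ⟨b, hb, hd⟩ := Metric.mem_closure_iff.1 hcl δ hδ
    exact ⟨b, hb, by rwa [Real.dist_eq] at hd⟩
  obtain ⟨b, hb, hbe⟩ := hb
  refine ⟨b, hb, fun x hx => ?_⟩
  have h1 : |x - b| ^ r ≤ |x - e| ^ r + ε := by
    refine h _ _ ?_ ?_ ?_
    · exact abs_le.2 ⟨by linarith [hx.1, hb.2], by linarith [hx.2, hb.1]⟩
    · exact abs_le.2 ⟨by linarith [hx.1], by linarith [hx.2]⟩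
    · rwa [show x - b - (x - e) = e - b by ring]
  have h2 : |x - e| ≤ |x - a| := by
    rcases le_total a u with hau | hau
    · have : e = u := by rw [he, min_eq_left (hau.trans huv.le), max_eq_left hau]
      rw [this, abs_of_nonneg (by linarith [hx.1]), abs_of_nonneg (by linarith [hx.1])]
      linarith
    · rcases le_total a v with hav | hav
      · have : e = a := by rw [he, min_eq_left hav, max_eq_right hau]
        rw [this]
      · have : e = v := by rw [he, min_eq_right hav, max_eq_right huv.le]
        rw [this, abs_of_nonpos (by linarith [hx.2]), abs_of_nonpos (by linarith [hx.2])]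
        linarith
  have h3 := Real.rpow_le_rpow (abs_nonneg _) h2 (by linarith : 0 ≤ r)
  linarith

/-- For `x ≤ y` and `a ≤ b` the crossing difference is monotone: this is the Monge condition. -/
lemma abs_rpow_monge {r : ℝ} (hr : 1 ≤ r) {a b x y : ℝ} (hab : a ≤ b) (hxy : x ≤ y) :
    |x - a| ^ r + |y - b| ^ r ≤ |x - b| ^ r + |y - a| ^ r := by
  have hconv : ConvexOn ℝ Set.univ (fun z : ℝ => |z| ^ r) := by
    have h1 : ConvexOn ℝ (Ici 0) fun z : ℝ => z ^ r := convexOn_rpow hr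
    have h2 : ConvexOn ℝ Set.univ fun z : ℝ => |z| := convexOn_univ_norm
    refine ⟨convex_univ, fun z _ w _ s t hs ht hst => ?_⟩
    calc |s • z + t • w| ^ r ≤ (s • |z| + t • |w|) ^ r :=
          Real.rpow_le_rpow (abs_nonneg _) (h2.2 trivial trivial hs ht hst) (by linarith)
      _ ≤ s • |z| ^ r + t • |w| ^ r := h1.2 (abs_nonneg z) (abs_nonneg w) hs ht hst
  rcases hab.eq_or_lt with rfl | hab
  · linarith
  rcases hxy.eq_or_lt with rfl | hxy
  · linarith
  set w := (b - a) + (y - x) with hw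
  have hwpos : 0 < w := by linarith
  have hs : 0 ≤ (y - x) / w := div_nonneg (by linarith) hwpos.le
  have ht : 0 ≤ (b - a) / w := div_nonneg (by linarith) hwpos.le
  have hst : (y - x) / w + (b - a) / w = 1 := by
    rw [← add_div, div_eq_one_iff_eq hwpos.ne']
    ring
  have hA := hconv.2 (mem_univ (x - b)) (mem_univ (y - a)) hs ht hst
  have hB := hconv.2 (mem_univ (x - b)) (mem_univ (y - a)) ht hs (by linarith)
  have eA : ((y - x) / w) • (x - b) + ((b - a) / w) • (y - a) = x - a := by
    simp only [smul_eq_mul]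
    field_simp
    ring
  have eB : ((b - a) / w) • (x - b) + ((y - x) / w) • (y - a) = y - b := by
    simp only [smul_eq_mul]
    field_simp
    ring
  rw [eA] at hA
  rw [eB] at hB
  simp only [smul_eq_mul] at hA hB
  have hs' : (b - a) / w = 1 - (y - x) / w := by linarith
  rw [hs'] at hA hB
  linarith

namespace BddDensity

variable {μ : Measure ℝ} {c d m M : ℝ}

lemma upper_pos (h : BddDensity μ c d m M) : 0 < M := h.pos.trans_le h.le

lemma noAtom (h : BddDensity μ c d m M) (x : ℝ) : μ {x} = 0 := by
  have := h.upper {x}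
  simpa using this

lemma exists_cut (h : BddDensity μ c d m M) [IsProbabilityMeasure μ] {A : Set ℝ} {y : ℝ}
    (hy : y ∈ Icc 0 (μ.real A)) :
    ∃ t ∈ Icc c d, μ.real (A ∩ Iic t) = y := by
  have hmono : ∀ s t, s ≤ t → μ.real (A ∩ Iic s) ≤ μ.real (A ∩ Iic t) := fun s t hst =>
    measureReal_mono (inter_subset_inter_right _ (Iic_subset_Iic.2 hst))
  have hlip : ∀ s t, s ≤ t → μ.real (A ∩ Iic t) ≤ μ.real (A ∩ Iic s) + M * (t - s) := by
    intro s t hst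
    have h1 : A ∩ Iic t ⊆ (A ∩ Iic s) ∪ Ioc s t := by
      intro x hx
      rcases le_or_gt x s with hxs | hxs
      · exact Or.inl ⟨hx.1, hxs⟩
      · exact Or.inr ⟨hxs, hx.2⟩
    have h2 : μ.real (Ioc s t) ≤ M * (t - s) := by
      have := h.upper (Ioc s t)
      rw [Measure.smul_apply, Real.volume_Ioc, smul_eq_mul,
        ← ENNReal.ofReal_mul h.upper_pos.le] at this
      exact ENNReal.toReal_le_of_le_ofReal
        (mul_nonneg h.upper_pos.le (by linarith)) this
    exact (measureReal_mono h1).trans ((measureReal_union_le _ _).trans (by linarith))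
  have hcont : Continuous fun t => μ.real (A ∩ Iic t) := by
    refine (LipschitzWith.of_dist_le_mul (K := M.toNNReal) fun s t => ?_).continuous
    rw [Real.coe_toNNReal _ h.upper_pos.le, Real.dist_eq, Real.dist_eq]
    rcases le_total s t with hst | hst
    · rw [abs_of_nonpos (by linarith [hmono s t hst]), abs_of_nonpos (by linarith)]
      linarith [hlip s t hst]
    · rw [abs_of_nonneg (by linarith [hmono t s hst]), abs_of_nonneg (by linarith)]
      linarith [hlip t s hst]
  have hc : μ.real (A ∩ Iic c) = 0 := by
    have : μ (A ∩ Iic c) = 0 := by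
      refine measure_mono_null (t := (Icc c d)ᶜ ∪ {c}) ?_
        (measure_union_null h.compl_null (h.noAtom c))
      intro x hx
      rcases (mem_Iic.1 hx.2).lt_or_eq with hxc | hxc
      · exact Or.inl fun hx' => hxc.not_ge hx'.1
      · exact Or.inr hxc
    simp [Measure.real, this]
  have hd : μ.real (A ∩ Iic d) = μ.real A := by
    refine le_antisymm (measureReal_mono inter_subset_left) ?_
    have : A ⊆ (A ∩ Iic d) ∪ (Icc c d)ᶜ := by
      intro x hx
      by_cases hxd : x ∈ Icc c d
      · exact Or.inl ⟨hx, hxd.2⟩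
      · exact Or.inr hxd
    have h1 := (measureReal_mono (μ := μ) this).trans (measureReal_union_le _ _)
    have h2 : μ.real (Icc c d)ᶜ = 0 := by simp [Measure.real, h.compl_null]
    linarith
  have := intermediate_value_Icc h.lt.le hcont.continuousOn
  simp only [hc, hd] at this
  exact this hy

/-- A partition of the line into `n` consecutive intervals with prescribed masses; `idx x` is
the index of the interval containing `x`. -/
lemma exists_partition (h : BddDensity μ c d m M) [IsProbabilityMeasure μ] {n : ℕ} (hn : 0 < n)
    {p : ℕ → ℝ} (hp : ∀ i < n, 0 < p i) (hsum : ∑ i ∈ Finset.range n, p i = 1) :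
    ∃ (t : ℕ → ℝ) (idx : ℝ → ℕ), Measurable idx ∧ (∀ k ≤ n, t k ∈ Icc c d) ∧
      (∀ k < n, t k < t (k + 1)) ∧ (∀ i j, i ≤ j → j ≤ n → t i ≤ t j) ∧ (∀ x, idx x < n) ∧
      (∀ k, (idx ⁻¹' {k}).OrdConnected) ∧ (∀ k < n, Ioc (t k) (t (k + 1)) ⊆ idx ⁻¹' {k}) ∧
      (∀ᵐ x ∂μ, x ∈ Ioc (t (idx x)) (t (idx x + 1))) ∧
      ∀ k < n, μ (idx ⁻¹' {k}) = ENNReal.ofReal (p k) := by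
  set P : ℕ → ℝ := fun k => ∑ i ∈ Finset.range k, p i with hP
  have hPsucc : ∀ k, P (k + 1) = P k + p k := fun k => Finset.sum_range_succ _ _
  have hP0 : ∀ k ≤ n, 0 ≤ P k := fun k hk => Finset.sum_nonneg fun i hi =>
    (hp i ((Finset.mem_range.1 hi).trans_le hk)).le
  have hP1 : ∀ k ≤ n, P k ≤ 1 := by
    intro k hk
    rw [← hsum]
    exact Finset.sum_le_sum_of_subset_of_nonneg (Finset.range_mono hk)
      fun i hi _ => (hp i (Finset.mem_range.1 hi)).le
  have hex : ∀ k, ∃ t ∈ Icc c d, k ≤ n → μ.real (Iic t) = P k := by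
    intro k
    by_cases hk : k ≤ n
    · obtain ⟨t, ht, hte⟩ := h.exists_cut (A := Set.univ) (y := P k)
        ⟨hP0 k hk, by simpa using hP1 k hk⟩
      exact ⟨t, ht, fun _ => by simpa using hte⟩
    · exact ⟨c, ⟨le_rfl, h.lt.le⟩, fun hk' => absurd hk' hk⟩
  choose t ht hG using hex
  have hlt : ∀ k < n, t k < t (k + 1) := by
    intro k hk
    by_contra! hc
    have := measureReal_mono (μ := μ) (Iic_subset_Iic.2 hc)
    rw [hG k hk.le, hG (k + 1) hk, hPsucc] at this
    linarith [hp k hk]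
  have hmono : ∀ i j, i ≤ j → j ≤ n → t i ≤ t j := by
    intro i j hij
    induction j, hij using Nat.le_induction with
    | base => exact fun _ => le_rfl
    | succ j hij ih => exact fun hj => (ih (by omega)).trans (hlt j (by omega)).le
  let idx : ℝ → ℕ := fun x => Nat.findGreatest (fun k => t k < x) (n - 1)
  have hidx : ∀ x k, idx x = k ↔
      k ≤ n - 1 ∧ (k ≠ 0 → t k < x) ∧ ∀ ⦃j : ℕ⦄, k < j → j ≤ n - 1 → ¬ t j < x :=
    fun x k => Nat.findGreatest_eq_iff
  have hsub : ∀ k < n, Ioc (t k) (t (k + 1)) ⊆ idx ⁻¹' {k} := by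
    intro k hk x hx
    refine (hidx x k).2 ⟨by omega, fun _ => hx.1, fun j hj hj' => ?_⟩
    exact not_lt.2 (hx.2.trans (hmono _ _ hj (by omega)))
  have hae : ∀ᵐ x ∂μ, x ∈ Ioc (t (idx x)) (t (idx x + 1)) := by
    have h0 : ∀ᵐ x ∂μ, t 0 < x := by
      have h1 : μ.real (Iic (t 0)) = 0 := by
        rw [hG 0 (Nat.zero_le _)]
        simp [hP]
      have h2 : μ (Iic (t 0)) = 0 := (measureReal_eq_zero_iff).1 h1
      rw [ae_iff]
      exact measure_mono_null (fun x hx => not_lt.1 hx) h2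
    have h1 : ∀ᵐ x ∂μ, x ≤ t n := by
      have h1 : μ.real (Iic (t n)) = 1 := by
        rw [hG n le_rfl, ← hsum]
      have h2 : μ (Iic (t n)) = 1 := by
        rw [← ENNReal.toReal_eq_one_iff]
        exact h1
      exact (prob_compl_eq_zero_iff measurableSet_Iic).2 h2
    filter_upwards [h0, h1] with x hx0 hx1
    obtain ⟨ha, hb, hc⟩ := (hidx x (idx x)).1 rfl
    constructor
    · by_cases h00 : idx x = 0
      · rw [h00]
        exact hx0
      · exact hb h00
    · by_cases hle : idx x + 1 ≤ n - 1
      · exact not_lt.1 (hc (Nat.lt_succ_self _) hle)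
      · have : idx x + 1 = n := by omega
        rw [this]
        exact hx1
  refine ⟨t, idx, ?_, fun k _ => ht k, hlt, hmono, fun x => ?_, fun k => ⟨?_⟩, hsub, hae, ?_⟩
  · exact measurable_findGreatest fun k _ => measurableSet_Ioi
  · have := ((hidx x (idx x)).1 rfl).1
    omega
  · intro x hx y hy z hz
    obtain ⟨hx1, hx2, hx3⟩ := (hidx x k).1 hx
    obtain ⟨hy1, hy2, hy3⟩ := (hidx y k).1 hy
    exact (hidx z k).2 ⟨hx1, fun h0 => (hx2 h0).trans_le hz.1,
      fun j hj hj' => not_lt.2 (hz.2.trans (not_lt.1 (hy3 hj hj')))⟩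
  · intro k hk
    have h1 : μ (idx ⁻¹' {k}) = μ (Ioc (t k) (t (k + 1))) := by
      refine le_antisymm (measure_mono_ae ?_) (measure_mono (hsub k hk))
      filter_upwards [hae] with x hx hxk
      have hxk : idx x = k := hxk
      rwa [hxk] at hx
    have h2 : Iic (t (k + 1)) \ Iic (t k) = Ioc (t k) (t (k + 1)) := by
      ext x
      simp
    have h3 := measureReal_sdiff (μ := μ) (s₁ := Iic (t (k + 1))) (s₂ := Iic (t k))
      (Iic_subset_Iic.2 (hlt k hk).le) measurableSet_Iic
    rw [h2, hG k hk.le, hG (k + 1) hk, hPsucc] at h3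
    rw [h1, ← ofReal_measureReal, h3]
    congr 1
    ring

end BddDensity

lemma hasMasses_comp_index {μ : Measure ℝ} {n : ℕ} {b p : ℕ → ℝ} {idx : ℝ → ℕ}
    (hidx : Measurable idx) (hlt : ∀ x, idx x < n) (hp : ∀ i < n, 0 < p i)
    (hb : ∀ i j, i < j → j < n → b i < b j)
    (hmass : ∀ k < n, μ (idx ⁻¹' {k}) = ENNReal.ofReal (p k)) :
    HasMasses μ (b ∘ idx) n b p ∧ (Set.range (b ∘ idx)).Finite ∧
      ∀ k < n, (b ∘ idx) ⁻¹' {b k} = idx ⁻¹' {k} := by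
  have hinj : ∀ i < n, ∀ j < n, b i = b j → i = j := by
    intro i hi j hj hij
    rcases lt_trichotomy i j with h | h | h
    · exact absurd hij (hb i j h hj).ne
    · exact h
    · exact absurd hij (hb j i h hi).ne'
  have hfin : (Set.range (b ∘ idx)).Finite := by
    refine ((Finset.range n).image b).finite_toSet.subset ?_
    rintro _ ⟨x, rfl⟩
    simp only [Finset.coe_image, Finset.coe_range]
    exact ⟨idx x, hlt x, rfl⟩
  have hpre : ∀ k < n, (b ∘ idx) ⁻¹' {b k} = idx ⁻¹' {k} := by
    intro k hk
    ext x
    simp only [mem_preimage, Function.comp_apply, mem_singleton_iff]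
    exact ⟨fun hx => hinj _ (hlt x) _ hk hx, fun hx => by rw [hx]⟩
  refine ⟨⟨⟨measurable_from_nat.comp hidx, hfin.countable⟩, hinj, hp, fun k hk => ?_, ?_⟩,
    hfin, hpre⟩
  · rw [hpre k hk, hmass k hk]
  · intro y hy
    have : (b ∘ idx) ⁻¹' {y} = ∅ := by
      ext x
      simpa using hy _ (hlt x)
    rw [this, measure_empty]

/-- Monotone rearrangement: among all quantizers with prescribed codepoints and masses, the one
with consecutive interval cells has the smallest distortion. -/
lemma lintegral_comp_index_le {r : ℝ} (hr : 1 ≤ r) {μ : Measure ℝ} [IsProbabilityMeasure μ]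
    {q : ℝ → ℝ} {n : ℕ} {a p : ℕ → ℝ} (hq : HasMasses μ q n a p)
    (ha : ∀ i j, i < j → j < n → a i < a j) {t : ℕ → ℝ} {idx : ℝ → ℕ} (hidx : Measurable idx)
    (ht : ∀ i j, i ≤ j → j ≤ n → t i ≤ t j) (hlt : ∀ x, idx x < n)
    (hae : ∀ᵐ x ∂μ, x ∈ Ioc (t (idx x)) (t (idx x + 1)))
    (hmass : ∀ k < n, μ (idx ⁻¹' {k}) = ENNReal.ofReal (p k)) :
    distortion r μ (a ∘ idx) ≤ distortion r μ q := by
  obtain ⟨hT, -, -⟩ := hasMasses_comp_index hidx hlt hq.pos ha hmass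
  -- the Kantorovich potential of the codepoints
  let ψ : ℕ → ℝ := fun k => ∑ i ∈ Finset.range k,
    (|t (i + 1) - a (i + 1)| ^ r - |t (i + 1) - a i| ^ r)
  have hψ : ∀ k, ψ (k + 1) = ψ k + (|t (k + 1) - a (k + 1)| ^ r - |t (k + 1) - a k| ^ r) :=
    fun k => Finset.sum_range_succ _ _
  have hup : ∀ k j, k ≤ j → j < n → ∀ x ≤ t (k + 1),
      |x - a k| ^ r - ψ k ≤ |x - a j| ^ r - ψ j := by
    intro k j hkj
    induction j, hkj using Nat.le_induction with
    | base => exact fun _ _ _ => le_rfl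
    | succ j hkj ih =>
      intro hj x hx
      have h1 := ih (by omega) x hx
      have h2 := abs_rpow_monge hr (ha j (j + 1) (by omega) hj).le
        (hx.trans (ht (k + 1) (j + 1) (by omega) (by omega)))
      rw [hψ j]
      linarith
  have hdown : ∀ k j, j ≤ k → k < n → ∀ x, t k ≤ x →
      |x - a k| ^ r - ψ k ≤ |x - a j| ^ r - ψ j := by
    intro k j hjk
    induction k, hjk using Nat.le_induction with
    | base => exact fun _ _ _ => le_rfl
    | succ k hjk ih =>
      intro hk x hx
      have h1 := ih (by omega) x ((ht k (k + 1) (by omega) (by omega)).trans hx)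
      have h2 := abs_rpow_monge hr (ha k (k + 1) (by omega) hk).le hx
      rw [hψ k]
      linarith
  let K : ℝ := ∑ i ∈ Finset.range n, |ψ i|
  have hK : ∀ k < n, 0 ≤ ψ k + K := by
    intro k hk
    have h1 : |ψ k| ≤ K := Finset.single_le_sum (f := fun i => |ψ i|)
      (fun i _ => abs_nonneg _) (Finset.mem_range.2 hk)
    linarith [neg_abs_le (ψ k)]
  let w : ℝ → ℝ≥0∞ := fun y => ∑ k ∈ Finset.range n,
    ({a k} : Set ℝ).indicator (fun _ => ENNReal.ofReal (ψ k + K)) y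
  have hwm : Measurable w := Finset.measurable_fun_sum _ fun k _ =>
    measurable_const.indicator (measurableSet_singleton _)
  have hw : ∀ k < n, w (a k) = ENNReal.ofReal (ψ k + K) := by
    intro k hk
    simp only [w]
    rw [Finset.sum_eq_single_of_mem k (Finset.mem_range.2 hk)]
    · simp
    · intro j hj hjk
      refine indicator_of_notMem ?_ _
      intro h
      exact hjk (hq.inj j (Finset.mem_range.1 hj) k hk h.symm)
  have hwint : ∀ {q' : ℝ → ℝ}, HasMasses μ q' n a p → ∫⁻ x, w (q' x) ∂μ =
      ∑ k ∈ Finset.range n, ENNReal.ofReal (ψ k + K) * ENNReal.ofReal (p k) := by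
    intro q' hq'
    simp only [w]
    rw [lintegral_finsetSum]
    · refine Finset.sum_congr rfl fun k hk => ?_
      have h1 : (fun x => ({a k} : Set ℝ).indicator (fun _ => ENNReal.ofReal (ψ k + K)) (q' x)) =
          (q' ⁻¹' {a k}).indicator fun _ => ENNReal.ofReal (ψ k + K) := by
        ext x
        simp [indicator]
      rw [h1, lintegral_indicator_const (hq'.meas _), hq'.mass k (Finset.mem_range.1 hk)]
    · intro k _
      exact (measurable_const.indicator (measurableSet_singleton _)).comp hq'.quant.1
  have hpt : ∀ᵐ x ∂μ, ENNReal.ofReal (|x - (a ∘ idx) x| ^ r) + w (q x) ≤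
      ENNReal.ofReal (|x - q x| ^ r) + w ((a ∘ idx) x) := by
    filter_upwards [hae, hq.ae_mem] with x hx hqx
    obtain ⟨j, hj, hqj⟩ := hqx
    have hk := hlt x
    rw [hqj, Function.comp_apply, hw j hj, hw _ hk,
      ← ENNReal.ofReal_add (Real.rpow_nonneg (abs_nonneg _) _) (hK j hj),
      ← ENNReal.ofReal_add (Real.rpow_nonneg (abs_nonneg _) _) (hK _ hk)]
    apply ENNReal.ofReal_le_ofReal
    rcases le_total (idx x) j with hkj | hkj
    · linarith [hup _ j hkj hj x hx.2]
    · linarith [hdown _ j hkj hk x hx.1.le]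
  have hint := lintegral_mono_ae hpt
  rw [lintegral_add_right (g := fun x => w (q x)) _ (hwm.comp hq.quant.1),
    lintegral_add_right (g := fun x => w ((a ∘ idx) x)) _ (hwm.comp hT.quant.1),
    hwint hq, hwint hT] at hint
  refine (ENNReal.add_le_add_iff_right ?_).1 hint
  exact (ENNReal.sum_lt_top.2 fun k _ =>
    ENNReal.mul_lt_top ENNReal.ofReal_lt_top ENNReal.ofReal_lt_top).ne

lemma distortion_le_add {r : ℝ} {μ : Measure ℝ} [IsProbabilityMeasure μ] {q q' : ℝ → ℝ} {ε : ℝ}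
    (hε : 0 ≤ ε) (h : ∀ᵐ x ∂μ, |x - q' x| ^ r ≤ |x - q x| ^ r + ε) :
    distortion r μ q' ≤ distortion r μ q + ENNReal.ofReal ε := by
  calc distortion r μ q' ≤ ∫⁻ x, (ENNReal.ofReal (|x - q x| ^ r) + ENNReal.ofReal ε) ∂μ := by
        refine lintegral_mono_ae ?_
        filter_upwards [h] with x hx
        rw [← ENNReal.ofReal_add (Real.rpow_nonneg (abs_nonneg _) _) hε]
        exact ENNReal.ofReal_le_ofReal hx
    _ = distortion r μ q + ENNReal.ofReal ε := by
        rw [lintegral_add_right _ measurable_const]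
        simp [distortion]

lemma exists_Qc_approx {r : ℝ} (hr : 1 ≤ r) {μ : Measure ℝ} [IsProbabilityMeasure μ]
    {c d m M : ℝ} (hμ : BddDensity μ c d m M) {q : ℝ → ℝ} {n : ℕ} {a p : ℕ → ℝ}
    (hq : HasMasses μ q n a p) (ha : ∀ i j, i < j → j < n → a i < a j) {ε : ℝ} (hε : 0 < ε) :
    ∃ q' b, Qc q' ∧ HasMasses μ q' n b p ∧
      distortion r μ q' ≤ distortion r μ q + ENNReal.ofReal ε := by
  obtain ⟨t, idx, hidx, -, htlt, htmono, hlt, hord, hsub, hae, hmass⟩ :=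
    hμ.exists_partition hq.card_pos hq.pos hq.sum_mass
  have hex : ∀ k, ∃ b, k < n → b ∈ Ioo (t k) (t (k + 1)) ∧
      ∀ x ∈ Icc (t k) (t (k + 1)), |x - b| ^ r ≤ |x - a k| ^ r + ε := by
    intro k
    by_cases hk : k < n
    · obtain ⟨b, hb⟩ := exists_interior_codepoint hr (htlt k hk) (a k) hε
      exact ⟨b, fun _ => hb⟩
    · exact ⟨0, fun h => absurd h hk⟩
  choose b hb using hex
  have hbs : ∀ i j, i < j → j < n → b i < b j := by
    intro i j hij hj
    exact ((hb i (hij.trans hj)).1.2.trans_le (htmono (i + 1) j hij hj.le)).trans (hb j hj).1.1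
  obtain ⟨hM, hfin, hpre⟩ := hasMasses_comp_index hidx hlt hq.pos hbs hmass
  refine ⟨b ∘ idx, b, ⟨hM.quant.1, hfin, ?_⟩, hM, ?_⟩
  · rintro _ ⟨x, rfl⟩
    have hk := hlt x
    rw [Function.comp_apply, hpre _ hk]
    exact ⟨hord _, subset_closure (hsub _ hk (Ioo_subset_Ioc_self (hb _ hk).1))⟩
  · refine le_trans (distortion_le_add hε.le (q := a ∘ idx) ?_) ?_
    · filter_upwards [hae] with x hx
      exact (hb _ (hlt x)).2 x (Ioc_subset_Icc_self hx)
    · gcongr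
      exact lintegral_comp_index_le hr hq ha hidx htmono hlt hae hmass

lemma lintegral_bump_le {r h : ℝ} (hr : 1 ≤ r) (hh : 0 < h) (a : ℝ) :
    ∫⁻ x, ENNReal.ofReal (h ^ r - |x - a| ^ r) ≤ ENNReal.ofReal (2 * (h ^ r * h * (r / (r + 1)))) := by
  have hr0 : 0 < r := by linarith
  rw [lintegral_sub_right_eq_self (fun x => ENNReal.ofReal (h ^ r - |x| ^ r)) a]
  let g : ℝ → ℝ := fun x => max (h ^ r - x ^ r) 0
  have hneg : ∀ x, h ≤ x → g x = 0 := fun x hx =>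
    max_eq_right (sub_nonpos.2 (Real.rpow_le_rpow hh.le hx hr0.le))
  have hgpos : ∀ x, 0 ≤ x → x ≤ h → g x = h ^ r - x ^ r := fun x hx0 hx =>
    max_eq_left (sub_nonneg.2 (Real.rpow_le_rpow hx0 hx hr0.le))
  have hcont : Continuous fun x : ℝ => g |x| := by
    have : Continuous fun x : ℝ => |x| ^ r := continuous_abs.rpow_const fun _ => Or.inr hr0.le
    exact (continuous_const.sub this).max continuous_const
  have hsupp : HasCompactSupport fun x : ℝ => g |x| := by
    refine HasCompactSupport.intro (isCompact_Icc (a := -h) (b := h)) fun x hx => hneg _ ?_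
    by_contra! hc
    exact hx (abs_le.1 hc.le)
  have hint : Integrable fun x : ℝ => g |x| := hcont.integrable_of_hasCompactSupport hsupp
  have h1 : ∫⁻ x : ℝ, ENNReal.ofReal (h ^ r - |x| ^ r) = ENNReal.ofReal (∫ x : ℝ, g |x|) := by
    rw [ofReal_integral_eq_lintegral_ofReal hint (Eventually.of_forall fun x => le_max_right _ _)]
    refine lintegral_congr fun x => ?_
    simp only [g]
    rcases le_total (h ^ r - |x| ^ r) 0 with h0 | h0
    · rw [max_eq_right h0, ENNReal.ofReal_of_nonpos h0, ENNReal.ofReal_zero]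
    · rw [max_eq_left h0]
  have h2 : ∫ x in Ioi 0, g x = h ^ r * h * (r / (r + 1)) := by
    rw [setIntegral_eq_of_subset_of_forall_sdiff_eq_zero (s := Ioc 0 h) measurableSet_Ioi
      Ioc_subset_Ioi_self fun x hx => hneg x (not_lt.1 fun hxh => hx.2 ⟨hx.1, hxh.le⟩),
      setIntegral_congr_fun measurableSet_Ioc fun x hx => hgpos x hx.1.le hx.2,
      ← intervalIntegral.integral_of_le hh.le, intervalIntegral.integral_sub,
      integral_rpow (Or.inl (by linarith)), intervalIntegral.integral_const,
      Real.rpow_add_one hh.ne', Real.zero_rpow (by linarith)]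
    · simp only [smul_eq_mul]
      field_simp
      ring
    · exact intervalIntegrable_const
    · exact intervalIntegral.intervalIntegrable_rpow' (by linarith)
  rw [h1, integral_comp_abs, h2]

/-- Lower bound for the distortion of a quantizer with `n` codepoints of positive mass. -/
lemma le_distortion {r : ℝ} (hr : 1 ≤ r) {μ : Measure ℝ} [IsProbabilityMeasure μ]
    {c d m M : ℝ} (hμ : BddDensity μ c d m M) {q : ℝ → ℝ} {n : ℕ} {a p : ℕ → ℝ}
    (hq : HasMasses μ q n a p) :
    ENNReal.ofReal (m * (d - c) * ((d - c) / (2 * n)) ^ r / (r + 1)) ≤ distortion r μ q := by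
  have hn : (0 : ℝ) < n := by exact_mod_cast hq.card_pos
  have hlen : 0 < d - c := sub_pos.2 hμ.lt
  set h := (d - c) / (2 * n) with hh
  have hpos : 0 < h := by positivity
  set ν := ENNReal.ofReal m • volume.restrict (Icc c d) with hν
  have hpt : ∀ᵐ x ∂ν, ENNReal.ofReal (h ^ r) ≤ ENNReal.ofReal (|x - q x| ^ r) +
      ∑ k ∈ Finset.range n, ENNReal.ofReal (h ^ r - |x - a k| ^ r) := by
    filter_upwards [ae_mono hμ.lower hq.ae_mem] with x hx
    obtain ⟨k, hk, hqk⟩ := hx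
    calc ENNReal.ofReal (h ^ r)
        ≤ ENNReal.ofReal (|x - q x| ^ r) + ENNReal.ofReal (h ^ r - |x - a k| ^ r) := by
          rw [hqk]
          refine le_trans ?_ ENNReal.ofReal_add_le
          rw [add_sub_cancel]
      _ ≤ _ := by
          gcongr
          exact Finset.single_le_sum
            (f := fun k => ENNReal.ofReal (h ^ r - |x - a k| ^ r)) (fun _ _ => zero_le)
            (Finset.mem_range.2 hk)
  have hmeas : ∀ k, Measurable fun x => ENNReal.ofReal (h ^ r - |x - a k| ^ r) := by
    intro k
    fun_prop
  have hint := lintegral_mono_ae hpt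
  have hsum : ∫⁻ x, ∑ k ∈ Finset.range n, ENNReal.ofReal (h ^ r - |x - a k| ^ r) ∂ν ≤
      ENNReal.ofReal (n * (m * (2 * (h ^ r * h * (r / (r + 1)))))) := by
    rw [lintegral_finsetSum _ fun k _ => hmeas k]
    refine (Finset.sum_le_card_nsmul _ _
      (ENNReal.ofReal (m * (2 * (h ^ r * h * (r / (r + 1)))))) fun k _ => ?_).trans_eq ?_
    · rw [hν, lintegral_smul_measure, ENNReal.ofReal_mul hμ.pos.le, smul_eq_mul]
      gcongr
      exact (setLIntegral_le_lintegral _ _).trans (lintegral_bump_le hr hpos (a k))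
    · rw [Finset.card_range, nsmul_eq_mul, ENNReal.ofReal_mul hn.le, ENNReal.ofReal_natCast]
  have hleft : ∫⁻ _, ENNReal.ofReal (h ^ r) ∂ν = ENNReal.ofReal (h ^ r * (m * (d - c))) := by
    rw [lintegral_const, hν, Measure.smul_apply, Measure.restrict_apply_univ, Real.volume_Icc,
      smul_eq_mul, ← ENNReal.ofReal_mul hμ.pos.le, ← ENNReal.ofReal_mul (by positivity)]
  rw [lintegral_add_right _ (Finset.measurable_fun_sum _ fun k _ => hmeas k), hleft] at hint
  have hmain : ENNReal.ofReal (h ^ r * (m * (d - c))) ≤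
      distortion r μ q + ENNReal.ofReal (n * (m * (2 * (h ^ r * h * (r / (r + 1)))))) :=
    hint.trans (add_le_add (lintegral_mono' hμ.lower le_rfl) hsum)
  have hid : h ^ r * (m * (d - c)) = m * (d - c) * h ^ r / (r + 1) +
      n * (m * (2 * (h ^ r * h * (r / (r + 1))))) := by
    have : d - c = 2 * n * h := by
      rw [hh]
      field_simp
    rw [this]
    have hr1 : r + 1 ≠ 0 := by linarith
    field_simp
    ring
  have hm := hμ.pos
  rw [hid, ENNReal.ofReal_add (by positivity) (by positivity)] at hmain
  exact (ENNReal.add_le_add_iff_right ENNReal.ofReal_ne_top).1 hmain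

/-- A quantizer with `n` codecells of equal mass and small distortion. -/
lemma exists_uniform {r : ℝ} (hr : 1 ≤ r) {μ : Measure ℝ} [IsProbabilityMeasure μ]
    {c d m M : ℝ} (hμ : BddDensity μ c d m M) {n : ℕ} (hn : 0 < n) :
    ∃ q a, HasMasses μ q n a (fun _ => (n : ℝ)⁻¹) ∧
      distortion r μ q ≤ ENNReal.ofReal (((n : ℝ) * m)⁻¹ ^ r) := by
  have hn' : (0 : ℝ) < n := by exact_mod_cast hn
  obtain ⟨t, idx, hidx, htm, htlt, htmono, hlt, hord, hsub, hae, hmass⟩ :=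
    hμ.exists_partition hn (p := fun _ => (n : ℝ)⁻¹) (fun _ _ => inv_pos.2 hn') (by
      simp [hn'.ne'])
  have hts : ∀ i j, i < j → j < n → t i < t j := fun i j hij hj =>
    (htlt i (hij.trans hj)).trans_le (htmono _ _ hij hj.le)
  obtain ⟨hM, -, -⟩ := hasMasses_comp_index hidx hlt (fun _ _ => inv_pos.2 hn') hts hmass
  refine ⟨t ∘ idx, t, hM, ?_⟩
  have hlen : ∀ k < n, t (k + 1) - t k ≤ ((n : ℝ) * m)⁻¹ := by
    intro k hk
    have h1 := (hμ.lower (Ioc (t k) (t (k + 1)))).trans (measure_mono (hsub k hk))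
    rw [hmass k hk, Measure.smul_apply, Measure.restrict_apply measurableSet_Ioc,
      inter_eq_left.2 fun x (hx : x ∈ Ioc _ _) => mem_Icc.2 ⟨(htm k hk.le).1.trans hx.1.le, hx.2.trans (htm (k + 1) hk).2⟩,
      Real.volume_Ioc, smul_eq_mul, ← ENNReal.ofReal_mul hμ.pos.le,
      ENNReal.ofReal_le_ofReal_iff (inv_pos.2 hn').le] at h1
    rw [mul_inv, ← div_eq_mul_inv, le_div_iff₀ hμ.pos]
    linarith
  calc distortion r μ (t ∘ idx) ≤ ∫⁻ _, ENNReal.ofReal (((n : ℝ) * m)⁻¹ ^ r) ∂μ := by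
        refine lintegral_mono_ae ?_
        filter_upwards [hae] with x hx
        refine ENNReal.ofReal_le_ofReal (Real.rpow_le_rpow (abs_nonneg _) ?_ (by linarith))
        rw [Function.comp_apply, abs_of_pos (sub_pos.2 hx.1)]
        linarith [hx.2, hlen _ (hlt x)]
    _ = _ := by simp

/-- Splitting a codecell into two halves of equal mass. -/
lemma exists_split {r : ℝ} (hr : 1 ≤ r) {μ : Measure ℝ} [IsProbabilityMeasure μ]
    {c d m M : ℝ} (hμ : BddDensity μ c d m M) {q : ℝ → ℝ} {n : ℕ} {a p : ℕ → ℝ}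
    (hq : HasMasses μ q n a p) {k : ℕ} (hk : k < n) {ε : ℝ} (hε : 0 < ε) :
    ∃ q' a', HasMasses μ q' (n + 1) a' (fun i => if i = k ∨ i = n then p k / 2 else p i) ∧
      distortion r μ q' ≤ distortion r μ q + ENNReal.ofReal ε := by
  have hpk := hq.pos k hk
  have hA : μ.real (q ⁻¹' {a k}) = p k := by
    rw [Measure.real, hq.mass k hk, ENNReal.toReal_ofReal hpk.le]
  obtain ⟨t, -, htG⟩ := hμ.exists_cut (A := q ⁻¹' {a k}) (y := p k / 2)
    ⟨by linarith, by rw [hA]; linarith⟩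
  obtain ⟨δ, hδ, hcont⟩ := abs_rpow_le_add hr (|c| + |d| + |a k| + 1) hε
  obtain ⟨y, hyr, hyd⟩ := Metric.dense_iff.1 (hq.quant.2.dense_compl ℝ) (a k) (min δ 1)
    (lt_min hδ one_pos)
  rw [Metric.mem_ball, Real.dist_eq] at hyr
  have hrange : ∀ i < n, a i ∈ Set.range q := by
    intro i hi
    by_contra hc
    have := (hq.pos_iff (a i)).2 ⟨i, hi, rfl⟩
    rw [Set.preimage_singleton_eq_empty.2 hc] at this
    simp at this
  have hya : ∀ i < n, a i ≠ y := fun i hi h => hyd (h ▸ hrange i hi)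
  have hqy : ∀ x, q x ≠ y := fun x h => hyd ⟨x, h⟩
  let q' : ℝ → ℝ := fun x => if q x = a k ∧ t < x then y else q x
  have hq'm : Measurable q' :=
    Measurable.ite ((hq.meas (a k)).inter measurableSet_Ioi) measurable_const hq.quant.1
  have hq'r : (Set.range q').Countable := by
    refine (hq.quant.2.union (countable_singleton y)).mono ?_
    rintro _ ⟨x, rfl⟩
    simp only [q']
    split_ifs
    · exact Or.inr rfl
    · exact Or.inl ⟨x, rfl⟩
  refine ⟨q', Function.update a n y, ⟨⟨hq'm, hq'r⟩, ?_, ?_, ?_, ?_⟩, ?_⟩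
  · intro i hi j hj hij
    by_cases hin : i = n
    · by_cases hjn : j = n
      · omega
      · subst hin
        rw [Function.update_self, Function.update_of_ne hjn] at hij
        exact absurd hij.symm (hya j (by omega))
    · by_cases hjn : j = n
      · subst hjn
        rw [Function.update_self, Function.update_of_ne hin] at hij
        exact absurd hij (hya i (by omega))
      · rw [Function.update_of_ne hjn, Function.update_of_ne hin] at hij
        exact hq.inj i (by omega) j (by omega) hij
  · intro i hi
    split_ifs with h
    · linarith
    · push Not at h
      exact hq.pos i (by omega)
  · intro i hi
    by_cases hin : i = n
    · subst hin
      have hpre : q' ⁻¹' {y} = q ⁻¹' {a k} \ (q ⁻¹' {a k} ∩ Iic t) := by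
        ext x
        have := hqy x
        by_cases h1 : q x = a k <;> by_cases h2 : t < x <;> simp_all [q']
      have h3 := measureReal_sdiff (μ := μ) (s₁ := q ⁻¹' {a k}) (s₂ := q ⁻¹' {a k} ∩ Iic t)
        inter_subset_left ((hq.meas _).inter measurableSet_Iic)
      rw [Function.update_self, if_pos (Or.inr rfl), hpre, ← ofReal_measureReal, h3, hA, htG]
      congr 1
      ring
    · rw [Function.update_of_ne hin]
      by_cases hik : i = k
      · subst hik
        have hpre : q' ⁻¹' {a i} = q ⁻¹' {a i} ∩ Iic t := by
          ext x
          have := (hya i hk).symm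
          by_cases h1 : q x = a i <;> by_cases h2 : t < x <;> simp_all [q']
        rw [if_pos (Or.inl rfl), hpre, ← ofReal_measureReal, htG]
      · have hi' : i < n := by omega
        have hpre : q' ⁻¹' {a i} = q ⁻¹' {a i} := by
          ext x
          have h3 := (hya i hi').symm
          have h4 : a k ≠ a i := fun h => hik (hq.inj k hk i hi' h).symm
          by_cases h1 : q x = a k <;> by_cases h2 : t < x <;> simp [q', h1, h2, h3, h4]
        rw [if_neg (by tauto), hpre, hq.mass i hi']
  · intro x hx
    have hxy : y ≠ x := by
      have := hx n (Nat.lt_succ_self n)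
      rwa [Function.update_self] at this
    refine measure_mono_null (t := q ⁻¹' {x}) ?_ (hq.null x fun i hi => ?_)
    · intro z hz
      simp only [q', mem_preimage, mem_singleton_iff] at hz ⊢
      split_ifs at hz
      · exact absurd hz hxy
      · exact hz
    · have := hx i (by omega)
      rwa [Function.update_of_ne hi.ne] at this
  · refine distortion_le_add hε.le ?_
    have hsupp : ∀ᵐ x ∂μ, x ∈ Icc c d := hμ.compl_null
    filter_upwards [hsupp] with x hx
    simp only [q']
    split_ifs with h
    · have hxl : |x| ≤ |c| + |d| := by
        refine abs_le.2 ⟨?_, ?_⟩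
        · linarith [hx.1, neg_abs_le c, abs_nonneg d]
        · linarith [hx.2, le_abs_self d, abs_nonneg c]
      have hy1 : |y| ≤ |a k| + 1 := by
        have := abs_sub_abs_le_abs_sub y (a k)
        linarith [hyr.trans_le (min_le_right δ 1)]
      rw [h.1]
      refine hcont _ _ ?_ ?_ ?_
      · linarith [abs_sub x y]
      · linarith [abs_sub x (a k)]
      · rw [show x - y - (x - a k) = -(y - a k) by ring, abs_neg]
        exact hyr.trans_le (min_le_left _ _)
    · linarith

lemma msupport_compl_null (μ : Measure ℝ) : μ (msupport μ)ᶜ = 0 := by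
  refine measure_mono_null (compl_subset_compl.2 ?_) (Measure.measure_compl_support (μ := μ))
  intro x hx ε hε
  exact (Measure.mem_support_iff_forall x).1 hx _ (Ioo_mem_nhds (by linarith) (by linarith))

lemma bddDensity_of_essInf_essSup {μ : Measure ℝ} [IsProbabilityMeasure μ] {c d : ℝ}
    (hcd : c ≤ d) (hsupp : msupport μ = Set.Icc c d) {f : ℝ → ℝ} (hf_nonneg : 0 ≤ f)
    (hμ : μ = volume.withDensity fun x => ENNReal.ofReal (f x))
    (hpos : 0 < essInf f (volume.restrict (msupport μ)))
    (hbdd : ∃ B : ℝ, ∀ᵐ x ∂(volume.restrict (msupport μ)), f x ≤ B) :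
    BddDensity μ c d (essInf f (volume.restrict (msupport μ)))
      (essSup f (volume.restrict (msupport μ))) := by
  have hnull := msupport_compl_null μ
  rw [hsupp] at hpos hbdd hnull ⊢
  set m := essInf f (volume.restrict (Icc c d))
  set M := essSup f (volume.restrict (Icc c d))
  obtain ⟨B, hB⟩ := hbdd
  have hlow : ∀ᵐ x ∂(volume.restrict (Icc c d)), m ≤ f x :=
    ae_essInf_le ⟨0, eventually_map.2 (Eventually.of_forall fun x => hf_nonneg x)⟩
  have hupp : ∀ᵐ x ∂(volume.restrict (Icc c d)), f x ≤ M :=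
    ae_le_essSup ⟨B, eventually_map.2 hB⟩
  have hrestr : μ.restrict (Icc c d) =
      (volume.restrict (Icc c d)).withDensity fun x => ENNReal.ofReal (f x) := by
    rw [← restrict_withDensity measurableSet_Icc, ← hμ]
  have hself : μ.restrict (Icc c d) = μ := Measure.restrict_eq_self_of_ae_mem hnull
  have hupper : μ ≤ ENNReal.ofReal M • volume.restrict (Icc c d) := by
    rw [← withDensity_const, ← hself, hrestr]
    refine withDensity_mono ?_
    filter_upwards [hupp] with x hx
    exact ENNReal.ofReal_le_ofReal hx
  have hone : 1 ≤ ENNReal.ofReal M * ENNReal.ofReal (d - c) := by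
    have := hupper Set.univ
    simpa using this
  have hlt : c < d := by
    rcases hcd.eq_or_lt with rfl | h
    · simp at hone
    · exact h
  have hle : m ≤ M := by
    have hne : (ae (volume.restrict (Icc c d))).NeBot := by
      rw [ae_neBot, Ne, Measure.restrict_eq_zero, Real.volume_Icc, ENNReal.ofReal_eq_zero]
      linarith
    obtain ⟨x, hx⟩ := (hlow.and hupp).exists
    exact hx.1.trans hx.2
  refine ⟨hlt, hpos, hle, ?_, hnull, ?_, hupper.trans ?_⟩
  · rwa [← ENNReal.ofReal_mul (hpos.le.trans hle), ENNReal.one_le_ofReal] at hone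
  · rw [← withDensity_const]
    refine le_trans (withDensity_mono ?_) (hrestr.symm.le.trans Measure.restrict_le_self)
    filter_upwards [hlow] with x hx
    exact ENNReal.ofReal_le_ofReal hx
  · refine Measure.le_iff.2 fun s _ => ?_
    simp only [Measure.smul_apply]
    gcongr
    exact Measure.restrict_le_self

/-- The number of codepoints of positive mass. -/
def posCard (μ : Measure ℝ) (q : ℝ → ℝ) : ℕ :=
  {a : ℝ | a ∈ Set.range q ∧ 0 < μ (q ⁻¹' {a})}.ncard

lemma Qc.isQuantizer {q : ℝ → ℝ} (h : Qc q) : IsQuantizer q := ⟨h.1, h.2.1.countable⟩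

lemma posCard_le_exp {μ : Measure ℝ} [IsProbabilityMeasure μ] {q : ℝ → ℝ} (hq : IsQuantizer q)
    {α : EReal} (hα : α ≤ 0) {R : ℝ} (hR : renyiEntropy α μ q ≤ R) :
    (posCard μ q : ℝ) ≤ Real.exp R := by
  obtain ⟨n, a, p, h, -⟩ := exists_hasMasses_of_finite hq (finite_of_renyi_le hα hR hq)
  rw [posCard, h.ncard_eq]
  exact h.card_le_exp hα hR

/-- Every quantizer of finite entropy can be replaced by one in the class `Qc` with the same
masses, at an arbitrarily small cost in distortion. -/
lemma exists_Qc_of_isQuantizer {r : ℝ} (hr : 1 ≤ r) {μ : Measure ℝ} [IsProbabilityMeasure μ]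
    {c d m M : ℝ} (hμ : BddDensity μ c d m M) {q : ℝ → ℝ} (hq : IsQuantizer q)
    {α : EReal} (hα : α ≤ 0) {R : ℝ} (hR : renyiEntropy α μ q ≤ R) {ε : ℝ} (hε : 0 < ε) :
    ∃ q', Qc q' ∧ renyiEntropy α μ q' = renyiEntropy α μ q ∧ posCard μ q' = posCard μ q ∧
      distortion r μ q' ≤ distortion r μ q + ENNReal.ofReal ε := by
  obtain ⟨n, a, p, h, ha⟩ := exists_hasMasses_of_finite hq (finite_of_renyi_le hα hR hq)
  obtain ⟨q', b, hQ, h', hd⟩ := exists_Qc_approx hr hμ h ha hε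
  exact ⟨q', hQ, h'.renyi_congr h hα, by rw [posCard, posCard, h.ncard_eq, h'.ncard_eq], hd⟩

/-- The constant bounding from below the number of codecells relative to `exp R`. -/
def cardConst (r m M : ℝ) : ℝ := (m / M) ^ ((r + 1) / r) * (1 / (4 ^ r * (1 + r))) ^ (1 / r)

section cardConst

variable {r m M : ℝ}

lemma cardConst_pos (hr : 1 ≤ r) (hm : 0 < m) (hM : m ≤ M) : 0 < cardConst r m M := by
  have : 0 < M := hm.trans_le hM
  have : (0 : ℝ) < 4 ^ r := Real.rpow_pos_of_pos (by norm_num) _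
  unfold cardConst
  positivity

lemma cardConst_rpow (hr : 1 ≤ r) (hm : 0 < m) (hM : m ≤ M) :
    cardConst r m M ^ r = m ^ r * m / (M ^ r * M * (2 ^ r * 2 ^ r * (1 + r))) := by
  have hM0 : 0 < M := hm.trans_le hM
  have hr0 : r ≠ 0 := by linarith
  have h4 : (4 : ℝ) ^ r = 2 ^ r * 2 ^ r := by
    rw [← Real.mul_rpow (by norm_num) (by norm_num)]
    norm_num
  have h4p : (0 : ℝ) < 4 ^ r := Real.rpow_pos_of_pos (by norm_num) _
  rw [cardConst, Real.mul_rpow (by positivity) (by positivity), ← Real.rpow_mul (by positivity),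
    ← Real.rpow_mul (by positivity), div_mul_cancel₀ _ hr0, div_mul_cancel₀ _ hr0, Real.rpow_one,
    Real.div_rpow hm.le hM0.le, Real.rpow_add_one hm.ne', Real.rpow_add_one hM0.ne', h4,
    div_mul_div_comm, mul_one]

lemma cardConst_le (hr : 1 ≤ r) (hm : 0 < m) (hM : m ≤ M) : cardConst r m M ≤ 1 / 4 := by
  have hM0 : 0 < M := hm.trans_le hM
  have hr0 : 0 < r := by linarith
  have h4p : (0 : ℝ) < 4 ^ r := Real.rpow_pos_of_pos (by norm_num) _
  have h1 : (m / M) ^ ((r + 1) / r) ≤ 1 :=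
    Real.rpow_le_one (by positivity) ((div_le_one hM0).2 hM) (by positivity)
  have h2 : (1 / (4 ^ r * (1 + r))) ^ (1 / r) ≤ (1 / 4 : ℝ) := by
    have h3 : (1 / (4 ^ r * (1 + r))) ≤ (1 / 4 : ℝ) ^ r := by
      rw [Real.div_rpow (by norm_num) (by norm_num), Real.one_rpow]
      refine one_div_le_one_div_of_le h4p ?_
      nlinarith
    refine (Real.rpow_le_rpow (by positivity) h3 (by positivity)).trans_eq ?_
    rw [← Real.rpow_mul (by norm_num), mul_one_div_cancel hr0.ne', Real.rpow_one]
  calc cardConst r m M ≤ 1 * (1 / 4) := mul_le_mul h1 h2 (by positivity) zero_le_one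
    _ = 1 / 4 := one_mul _

end cardConst

/-- A quantizer can be replaced by one with sufficiently many codecells without increasing its
distortion. -/
lemma exists_many_cells {r : ℝ} (hr : 1 ≤ r) {μ : Measure ℝ} [IsProbabilityMeasure μ]
    {c d m M : ℝ} (hμ : BddDensity μ c d m M) {q : ℝ → ℝ} (hq : IsQuantizer q)
    {α : EReal} (hα : α ≤ 0) {R : ℝ} (hR0 : 0 ≤ R) (hR : renyiEntropy α μ q ≤ R) :
    ∃ q', IsQuantizer q' ∧ renyiEntropy α μ q' ≤ R ∧
      cardConst r m M * Real.exp R ≤ posCard μ q' ∧ distortion r μ q' ≤ distortion r μ q := by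
  obtain ⟨n, a, p, h, -⟩ := exists_hasMasses_of_finite hq (finite_of_renyi_le hα hR hq)
  by_cases hcard : cardConst r m M * Real.exp R ≤ n
  · exact ⟨q, hq, hR, by rwa [posCard, h.ncard_eq], le_rfl⟩
  push Not at hcard
  set K := cardConst r m M with hKdef
  have hK := cardConst_pos hr hμ.pos hμ.le
  have hK4 := cardConst_le hr hμ.pos hμ.le
  have hKr := cardConst_rpow hr hμ.pos hμ.le
  rw [← hKdef] at hK hK4 hKr
  set E := Real.exp R with hE
  have hE1 : 1 ≤ E := Real.one_le_exp hR0
  set N := ⌊E⌋₊ with hN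
  have hN1 : 1 ≤ N := Nat.le_floor (by simpa using hE1)
  have hN1' : (1 : ℝ) ≤ N := by exact_mod_cast hN1
  have hNE : (N : ℝ) ≤ E := Nat.floor_le (by linarith)
  have hEN : E ≤ 2 * N := by linarith [Nat.lt_floor_add_one E]
  obtain ⟨q', a', h', hd⟩ := exists_uniform hr hμ (n := N) hN1
  refine ⟨q', h'.quant, h'.renyi_uniform_le hα hNE, ?_, hd.trans (le_trans ?_
    (le_distortion hr hμ h))⟩
  · rw [posCard, h'.ncard_eq]
    nlinarith
  apply ENNReal.ofReal_le_ofReal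
  have hn : (0 : ℝ) < n := by exact_mod_cast h.card_pos
  have hm := hμ.pos
  have hM := hμ.upper_pos
  have hE0 : 0 < E := by linarith
  have hdc : 1 / M ≤ d - c := by
    rw [div_le_iff₀ hM, mul_comm]
    exact hμ.one_le
  have h1 : ((N : ℝ) * m)⁻¹ ≤ 2 / (E * m) := by
    rw [← one_div, div_le_div_iff₀ (by positivity) (by positivity)]
    nlinarith
  have hdc1 : 0 ≤ d - c := le_trans (by positivity) hdc
  have h2 : 1 / (2 * M * K * E) ≤ (d - c) / (2 * n) := by
    calc 1 / (2 * M * K * E) = 1 / M / (2 * (K * E)) := by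
          field_simp
      _ ≤ (d - c) / (2 * n) := by
          gcongr
  have hr0 : 0 ≤ r := by linarith
  calc (((N : ℝ) * m)⁻¹) ^ r ≤ (2 / (E * m)) ^ r := Real.rpow_le_rpow (by positivity) h1 hr0
    _ = m * (1 / M) * (1 / (2 * M * K * E)) ^ r / (r + 1) := by
        rw [Real.div_rpow (by norm_num) (by positivity), Real.mul_rpow hE0.le hm.le,
          Real.div_rpow (by norm_num) (by positivity), Real.mul_rpow (by positivity) hE0.le,
          Real.mul_rpow (by positivity) hK.le, Real.mul_rpow (by norm_num) hM.le, Real.one_rpow,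
          hKr]
        have e1 : 0 < E ^ r := Real.rpow_pos_of_pos hE0 _
        have e2 : 0 < m ^ r := Real.rpow_pos_of_pos hm _
        have e3 : 0 < M ^ r := Real.rpow_pos_of_pos hM _
        have e4 : (0 : ℝ) < 2 ^ r := Real.rpow_pos_of_pos (by norm_num) _
        have e5 : r + 1 ≠ 0 := by linarith
        have e6 : 1 + r ≠ 0 := by linarith
        field_simp
        ring
    _ ≤ m * (d - c) * ((d - c) / (2 * n)) ^ r / (r + 1) := by
        have h3 := Real.rpow_le_rpow (by positivity) h2 hr0
        gcongr

/-- If the entropy constraint is far from tight, a codecell can be split. -/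
lemma exists_more_cells {r : ℝ} (hr : 1 ≤ r) {μ : Measure ℝ} [IsProbabilityMeasure μ]
    {c d m M : ℝ} (hμ : BddDensity μ c d m M) {q : ℝ → ℝ} (hq : IsQuantizer q)
    {α : ℝ} (hα : α < 0) {R K : ℝ} (hK : 0 < K)
    (hKR : (2 ^ (1 - α) - 1) * K⁻¹ * Real.exp (-R) < 1)
    (hR : renyiEntropy α μ q ≤ R) (hcard : K * Real.exp R ≤ posCard μ q)
    (hslack : (1 / (1 - (2 ^ (1 - α) - 1) * K⁻¹ * Real.exp (-R))) ^ (1 / (1 - α)) <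
      Real.exp (R - (renyiEntropy α μ q).toReal)) {ε : ℝ} (hε : 0 < ε) :
    ∃ q', IsQuantizer q' ∧ renyiEntropy α μ q' ≤ R ∧ posCard μ q' = posCard μ q + 1 ∧
      distortion r μ q' ≤ distortion r μ q + ENNReal.ofReal ε := by
  have hα0 : (α : EReal) ≤ 0 := by exact_mod_cast hα.le
  have h1α : 0 < 1 - α := by linarith
  obtain ⟨n, a, p, h, -⟩ := exists_hasMasses_of_finite hq (finite_of_renyi_le hα0 hR hq)
  have hn := h.card_pos
  obtain ⟨k, hk, hmax⟩ := Finset.exists_max_image (Finset.range n) p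
    (Finset.nonempty_range_iff.2 hn.ne')
  have hkn := Finset.mem_range.1 hk
  have hpk := h.pos k hkn
  obtain ⟨q', a', h', hd⟩ := exists_split hr hμ h hkn hε
  have hcq : posCard μ q = n := h.ncard_eq
  refine ⟨q', h'.quant, ?_, by rw [hcq, posCard, h'.ncard_eq], hd⟩
  rw [hcq] at hcard
  rw [h.renyi_coe hα.le, EReal.toReal_coe] at hslack
  set S := ∑ i ∈ Finset.range n, p i ^ α with hS
  have hSpos : 0 < S := h.sum_rpow_pos α
  set x := (2 ^ (1 - α) - 1) * K⁻¹ * Real.exp (-R) with hx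
  have h2 : (1 : ℝ) < 2 ^ (1 - α) := Real.one_lt_rpow (by norm_num) h1α
  have hE := Real.exp_pos R
  have hx' : x = (2 ^ (1 - α) - 1) / (K * Real.exp R) := by
    rw [hx, Real.exp_neg]
    field_simp
  have hx0 : 0 < x := by
    rw [hx']
    exact div_pos (by linarith) (by positivity)
  have hsum : ∑ i ∈ Finset.range (n + 1), (if i = k ∨ i = n then p k / 2 else p i) ^ α =
      S + (2 ^ (1 - α) - 1) * p k ^ α := by
    have e1 : ∀ i ∈ Finset.range n, (if i = k ∨ i = n then p k / 2 else p i) ^ α =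
        p i ^ α + if i = k then (p k / 2) ^ α - p k ^ α else 0 := by
      intro i hi
      have hin : i ≠ n := (Finset.mem_range.1 hi).ne
      by_cases hik : i = k
      · subst hik
        simp
      · simp [hik, hin]
    rw [Finset.sum_range_succ, Finset.sum_congr rfl e1, Finset.sum_add_distrib,
      Finset.sum_ite_eq', if_pos hk, if_pos (Or.inr rfl), ← hS,
      Real.div_rpow hpk.le (by norm_num), sub_eq_add_neg 1 α, Real.rpow_add (by norm_num),
      Real.rpow_one, Real.rpow_neg (by norm_num)]
    have : (2 : ℝ) ^ α ≠ 0 := (Real.rpow_pos_of_pos (by norm_num) _).ne'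
    field_simp
    ring
  have hpkS : p k ^ α * (K * Real.exp R) ≤ S := by
    have e1 : ∀ i ∈ Finset.range n, p k ^ α ≤ p i ^ α := fun i hi =>
      Real.rpow_le_rpow_of_nonpos (h.pos i (Finset.mem_range.1 hi)) (hmax i hi) hα.le
    have e2 := Finset.card_nsmul_le_sum _ _ _ e1
    rw [Finset.card_range, nsmul_eq_mul] at e2
    have e3 : 0 < p k ^ α := Real.rpow_pos_of_pos hpk _
    nlinarith
  have hnew : S + (2 ^ (1 - α) - 1) * p k ^ α ≤ S * (1 / (1 - x)) := by
    have e1 : (2 ^ (1 - α) - 1) * p k ^ α ≤ S * x := by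
      rw [hx', mul_div_assoc', le_div_iff₀ (by positivity)]
      nlinarith
    have e2 : 1 + x ≤ 1 / (1 - x) := by
      rw [le_div_iff₀ (by linarith)]
      nlinarith
    nlinarith
  have hpos1 : 0 < 1 / (1 - x) := one_div_pos.2 (by linarith)
  have hlog : Real.log S + Real.log (1 / (1 - x)) ≤ (1 - α) * R := by
    have e1 := Real.log_le_log (Real.rpow_pos_of_pos hpos1 _) hslack.le
    rw [Real.log_exp, Real.log_rpow hpos1] at e1
    have e2 := mul_le_mul_of_nonneg_left e1 h1α.le
    have e3 : (1 - α) * (1 / (1 - α) * Real.log (1 / (1 - x))) = Real.log (1 / (1 - x)) := by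
      field_simp
    have e4 : (1 - α) * (R - (1 - α)⁻¹ * Real.log S) = (1 - α) * R - Real.log S := by
      field_simp
    rw [e3, e4] at e2
    linarith
  rw [h'.renyi_coe hα.le, EReal.coe_le_coe_iff, inv_mul_le_iff₀ h1α, hsum]
  refine (Real.log_le_log ?_ hnew).trans ?_
  · have e3 : 0 < p k ^ α := Real.rpow_pos_of_pos hpk _
    have e4 : 0 ≤ (2 ^ (1 - α) - 1) * p k ^ α := mul_nonneg (by linarith) e3.le
    linarith
  · rwa [Real.log_mul hSpos.ne' hpos1.ne']

lemma exists_tight_entropy {r : ℝ} (hr : 1 ≤ r) {μ : Measure ℝ} [IsProbabilityMeasure μ]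
    {c d m M : ℝ} (hμ : BddDensity μ c d m M) {α : ℝ} (hα : α < 0) {R K : ℝ} (hK : 0 < K)
    (hKR : (2 ^ (1 - α) - 1) * K⁻¹ * Real.exp (-R) < 1) (j : ℕ) {q : ℝ → ℝ}
    (hq : IsQuantizer q) (hR : renyiEntropy α μ q ≤ R)
    (hcard : K * Real.exp R ≤ posCard μ q) (hj : Real.exp R < posCard μ q + j)
    {ε : ℝ} (hε : 0 < ε) :
    ∃ q', IsQuantizer q' ∧ renyiEntropy α μ q' ≤ R ∧ K * Real.exp R ≤ posCard μ q' ∧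
      Real.exp (R - (renyiEntropy α μ q').toReal) ≤
        (1 / (1 - (2 ^ (1 - α) - 1) * K⁻¹ * Real.exp (-R))) ^ (1 / (1 - α)) ∧
      distortion r μ q' ≤ distortion r μ q + ENNReal.ofReal ε := by
  induction j generalizing q ε with
  | zero =>
    have := posCard_le_exp hq (by exact_mod_cast hα.le) hR
    simp only [Nat.cast_zero, add_zero] at hj
    linarith
  | succ j ih =>
    rcases le_or_gt (Real.exp (R - (renyiEntropy α μ q).toReal))
      ((1 / (1 - (2 ^ (1 - α) - 1) * K⁻¹ * Real.exp (-R))) ^ (1 / (1 - α))) with hs | hs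
    · exact ⟨q, hq, hR, hcard, hs, le_self_add⟩
    · obtain ⟨q₁, hq₁, hR₁, hc₁, hd₁⟩ :=
        exists_more_cells hr hμ hq hα hK hKR hR hcard hs (half_pos hε)
      have hc₁' : (posCard μ q₁ : ℝ) = posCard μ q + 1 := by exact_mod_cast hc₁
      push_cast at hj
      obtain ⟨q₂, hq₂, hR₂, hc₂, hs₂, hd₂⟩ := ih hq₁ hR₁ (by linarith) (by linarith) (half_pos hε)
      refine ⟨q₂, hq₂, hR₂, hc₂, hs₂, hd₂.trans ?_⟩
      calc distortion r μ q₁ + ENNReal.ofReal (ε / 2)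
          ≤ distortion r μ q + ENNReal.ofReal (ε / 2) + ENNReal.ofReal (ε / 2) := by gcongr
        _ = distortion r μ q + ENNReal.ofReal ε := by
            rw [add_assoc, ← ENNReal.ofReal_add (half_pos hε).le (half_pos hε).le, add_halves]

/-- the optimal error for `α ≤ 0` is attained over quantizers with
controlled codebook size (`H_R`), and moreover controlled entropy slack (`K_R(C)`). -/
theorem statement12
    (r : ℝ) (hr : 1 ≤ r)
    (μ : Measure ℝ) [IsProbabilityMeasure μ]
    (c d : ℝ) (hcd : c ≤ d) (hsupp : msupport μ = Set.Icc c d)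
    (f : ℝ → ℝ) (hf_meas : Measurable f) (hf_nonneg : 0 ≤ f)
    (hμ : μ = volume.withDensity fun x => ENNReal.ofReal (f x))
    (iF sF : ℝ)
    (hiF : iF = essInf f (volume.restrict (msupport μ)))
    (hsF : sF = essSup f (volume.restrict (msupport μ)))
    (hiF_pos : 0 < iF)
    (hbdd : ∃ B : ℝ, ∀ᵐ x ∂(volume.restrict (msupport μ)), f x ≤ B)
    (C : ℝ) (hC : C = (iF / sF) ^ ((r + 1) / r) * (1 / (4 ^ r * (1 + r))) ^ (1 / r)) :
    (∀ α : EReal, α ≤ 0 → ∀ R : ℝ, 0 ≤ R →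
      optErr r α μ R =
        ⨅ (q : ℝ → ℝ) (_ : Qc q ∧ renyiEntropy α μ q ≤ (R : EReal) ∧
            C * Real.exp R ≤ (({a : ℝ | a ∈ Set.range q ∧ 0 < μ (q ⁻¹' {a})}.ncard : ℝ)) ∧
            (({a : ℝ | a ∈ Set.range q ∧ 0 < μ (q ⁻¹' {a})}.ncard : ℝ)) ≤ Real.exp R),
          distortion r μ q) ∧
    (∀ α : ℝ, α < 0 → ∀ R : ℝ, Real.log ((2 ^ (1 - α) - 1) / C) < R →
      optErr r (α : EReal) μ R =
        ⨅ (q : ℝ → ℝ) (_ : Qc q ∧ renyiEntropy (α : EReal) μ q ≤ (R : EReal) ∧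
            C * Real.exp R ≤ (({a : ℝ | a ∈ Set.range q ∧ 0 < μ (q ⁻¹' {a})}.ncard : ℝ)) ∧
            (({a : ℝ | a ∈ Set.range q ∧ 0 < μ (q ⁻¹' {a})}.ncard : ℝ)) ≤ Real.exp R ∧
            Real.exp (R - (renyiEntropy (α : EReal) μ q).toReal) ≤
              (1 / (1 - (2 ^ (1 - α) - 1) * C⁻¹ * Real.exp (-R))) ^ (1 / (1 - α))),
          distortion r μ q) := by
  subst hiF hsF
  have hB := bddDensity_of_essInf_essSup hcd hsupp hf_nonneg hμ hiF_pos hbdd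
  set m := essInf f (volume.restrict (msupport μ))
  set M := essSup f (volume.restrict (msupport μ))
  have hC' : C = cardConst r m M := hC
  have hCpos : 0 < C := hC' ▸ cardConst_pos hr hB.pos hB.le
  have hC4 : C ≤ 1 / 4 := hC' ▸ cardConst_le hr hB.pos hB.le
  constructor
  · intro α hα R hR0
    apply le_antisymm
    · exact le_iInf₂ fun q hq => iInf₂_le q ⟨hq.1.isQuantizer, hq.2.1⟩
    · refine le_iInf₂ fun q hq => ENNReal.le_of_forall_pos_le_add fun ε hε _ => ?_
      obtain ⟨q₁, hq₁, hR₁, hc₁, hd₁⟩ := exists_many_cells hr hB hq.1 hα hR0 hq.2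
      obtain ⟨q₂, hq₂, hR₂, hc₂, hd₂⟩ :=
        exists_Qc_of_isQuantizer hr hB hq₁ hα hR₁ (ε := ε) (by exact_mod_cast hε)
      rw [ENNReal.ofReal_coe_nnreal] at hd₂
      have hle := posCard_le_exp hq₂.isQuantizer hα (hR₂ ▸ hR₁)
      rw [← hc₂, ← hC'] at hc₁
      exact (iInf₂_le q₂ ⟨hq₂, hR₂ ▸ hR₁, hc₁, hle⟩).trans (hd₂.trans (by gcongr))
  · intro α hα R hR
    have hα0 : (α : EReal) ≤ 0 := by exact_mod_cast hα.le
    have h2 : (2 : ℝ) < 2 ^ (1 - α) := by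
      conv_lhs => rw [← Real.rpow_one 2]
      exact Real.rpow_lt_rpow_of_exponent_lt (by norm_num) (by linarith)
    have hlt : (2 ^ (1 - α) - 1) / C < Real.exp R :=
      (Real.log_lt_iff_lt_exp (div_pos (by linarith) hCpos)).1 hR
    have hR0 : 0 ≤ R := by
      have h1 : 1 ≤ (2 ^ (1 - α) - 1) / C := by
        rw [le_div_iff₀ hCpos]
        linarith
      exact Real.one_le_exp_iff.1 (h1.trans hlt.le)
    have hKR : (2 ^ (1 - α) - 1) * C⁻¹ * Real.exp (-R) < 1 := by
      rwa [Real.exp_neg, ← div_eq_mul_inv, ← div_eq_mul_inv, div_lt_one (Real.exp_pos R)]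
    apply le_antisymm
    · exact le_iInf₂ fun q hq => iInf₂_le q ⟨hq.1.isQuantizer, hq.2.1⟩
    · refine le_iInf₂ fun q hq => ENNReal.le_of_forall_pos_le_add fun ε hε _ => ?_
      have hε' : (0 : ℝ) < ε := by exact_mod_cast hε
      obtain ⟨q₁, hq₁, hR₁, hc₁, hd₁⟩ := exists_many_cells hr hB hq.1 hα0 hR0 hq.2
      rw [← hC'] at hc₁
      obtain ⟨j, hj⟩ := exists_nat_gt (Real.exp R)
      obtain ⟨q₂, hq₂, hR₂, hc₂, hs₂, hd₂⟩ := exists_tight_entropy hr hB hα hCpos hKR j hq₁ hR₁ hc₁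
        (hj.trans_le (le_add_of_nonneg_left (Nat.cast_nonneg _))) (half_pos hε')
      obtain ⟨q₃, hq₃, hR₃, hc₃, hd₃⟩ :=
        exists_Qc_of_isQuantizer hr hB hq₂ hα0 hR₂ (half_pos hε')
      have hle := posCard_le_exp hq₃.isQuantizer hα0 (hR₃ ▸ hR₂)
      rw [← hc₃] at hc₂
      refine (iInf₂_le q₃ ⟨hq₃, hR₃ ▸ hR₂, hc₂, hle, hR₃ ▸ hs₂⟩).trans (hd₃.trans ?_)
      calc distortion r μ q₂ + ENNReal.ofReal (ε / 2)
          ≤ distortion r μ q + ENNReal.ofReal (ε / 2) + ENNReal.ofReal (ε / 2) := by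
            gcongr
            exact hd₂.trans (by gcongr)
        _ = distortion r μ q + ε := by
            rw [add_assoc, ← ENNReal.ofReal_add (half_pos hε').le (half_pos hε').le, add_halves,
              ENNReal.ofReal_coe_nnreal]

end
end

section
/- Let μ be a Borel probability measure on ℝ, r > 0, α ∈ [−∞, ∞], and let T : ℝ → ℝ be a similarity transformation with scaling number c > 0, i.e. a bijection with |Tx − Ty| = c·|x − y| for all x, y ∈ ℝ. Then for any R ≥ 0, D^α_{μ∘T⁻¹}(R) = c^r·D^α_μ(R). Moreover, C^α_{μ∘T⁻¹}(R) = { T∘q∘T⁻¹ : q ∈ C^α_μ(R) }, where C^α_μ(R) = { q ∈ Q^c : D_μ(q) = D^α_μ(R) } is the set of optimal quantizers in Q^c for μ under Rényi entropy constraint R of order α. -/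
open MeasureTheory Filter Set
open scoped ENNReal Topology Classical

noncomputable section

/-- Conjugation of self-maps of `ℝ` by a homeomorphism. -/
def conjHomeo (e : ℝ ≃ₜ ℝ) : (ℝ → ℝ) ≃ (ℝ → ℝ) := e.toEquiv.arrowCongr e.toEquiv

lemma conjHomeo_apply (e : ℝ ≃ₜ ℝ) (q : ℝ → ℝ) (x : ℝ) :
    conjHomeo e q x = e (q (e.symm x)) := rfl

lemma conjHomeo_symm_apply_self (e : ℝ ≃ₜ ℝ) (q : ℝ → ℝ) :
    conjHomeo e.symm (conjHomeo e q) = q := by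
  ext x
  simp [conjHomeo_apply]

lemma preimage_conjHomeo (e : ℝ ≃ₜ ℝ) (q : ℝ → ℝ) (a : ℝ) :
    conjHomeo e q ⁻¹' {e a} = e '' (q ⁻¹' {a}) := by
  rw [Homeomorph.image_eq_preimage_symm]
  ext x
  simp [conjHomeo_apply]

lemma range_conjHomeo (e : ℝ ≃ₜ ℝ) (q : ℝ → ℝ) :
    range (conjHomeo e q) = e '' range q := by
  change range (e ∘ q ∘ e.symm) = _
  rw [range_comp, e.symm.surjective.range_comp]

lemma map_preimage_conjHomeo (e : ℝ ≃ₜ ℝ) (μ : Measure ℝ) (q : ℝ → ℝ) (a : ℝ) :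
    μ.map e (conjHomeo e q ⁻¹' {e a}) = μ (q ⁻¹' {a}) := by
  rw [preimage_conjHomeo, e.measurableEmbedding.map_apply, preimage_image_eq _ e.injective]

lemma Measurable.conjHomeo {q : ℝ → ℝ} (hq : Measurable q) (e : ℝ ≃ₜ ℝ) :
    Measurable (conjHomeo e q) :=
  e.measurable.comp (hq.comp e.symm.measurable)

lemma IsQuantizer.conjHomeo {q : ℝ → ℝ} (hq : IsQuantizer q) (e : ℝ ≃ₜ ℝ) :
    IsQuantizer (conjHomeo e q) :=
  ⟨hq.1.conjHomeo e, by rw [range_conjHomeo]; exact hq.2.image e⟩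

lemma isQuantizer_conjHomeo_iff (e : ℝ ≃ₜ ℝ) (q : ℝ → ℝ) :
    IsQuantizer (conjHomeo e q) ↔ IsQuantizer q :=
  ⟨fun h => conjHomeo_symm_apply_self e q ▸ h.conjHomeo e.symm, fun h => h.conjHomeo e⟩

lemma Qc.conjHomeo {q : ℝ → ℝ} (hq : Qc q) (e : ℝ ≃ₜ ℝ) : Qc (conjHomeo e q) := by
  refine ⟨hq.1.conjHomeo e, by rw [range_conjHomeo]; exact hq.2.1.image e, ?_⟩
  rw [range_conjHomeo]
  rintro _ ⟨a, ha, rfl⟩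
  obtain ⟨hord, hcl⟩ := hq.2.2 a ha
  rw [preimage_conjHomeo]
  refine ⟨(hord.isPreconnected.image e e.continuous.continuousOn).ordConnected, ?_⟩
  rw [← e.image_closure]
  exact mem_image_of_mem e hcl

lemma qc_conjHomeo_iff (e : ℝ ≃ₜ ℝ) (q : ℝ → ℝ) : Qc (conjHomeo e q) ↔ Qc q :=
  ⟨fun h => conjHomeo_symm_apply_self e q ▸ h.conjHomeo e.symm, fun h => h.conjHomeo e⟩

lemma renyiEntropy_map_conjHomeo (e : ℝ ≃ₜ ℝ) (α : EReal) (μ : Measure ℝ) (q : ℝ → ℝ) :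
    renyiEntropy α (μ.map e) (conjHomeo e q) = renyiEntropy α μ q := by
  have key := map_preimage_conjHomeo e μ q
  unfold renyiEntropy
  congr 1
  · rw [← e.surjective.iSup_comp]
    simp only [key]
  · congr 1
    · rw [← e.surjective.iInf_comp]
      simp only [key, mem_ofPred_eq]
    · congr 1
      · rw [← e.toEquiv.tsum_eq]
        simp only [Homeomorph.coe_toEquiv, key]
      · rw [← e.toEquiv.tsum_eq]
        simp only [Homeomorph.coe_toEquiv, key]

lemma distortion_map_conjHomeo (e : ℝ ≃ₜ ℝ) {c : ℝ} (hc : 0 ≤ c)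
    (he : ∀ x y, |e x - e y| = c * |x - y|) (r : ℝ) (μ : Measure ℝ) (q : ℝ → ℝ) :
    distortion r (μ.map e) (conjHomeo e q) = ENNReal.ofReal (c ^ r) * distortion r μ q := by
  unfold distortion
  rw [e.measurableEmbedding.lintegral_map, ← lintegral_const_mul' _ _ ENNReal.ofReal_ne_top]
  refine lintegral_congr fun x => ?_
  rw [conjHomeo_apply, e.symm_apply_apply, he, Real.mul_rpow hc (abs_nonneg _),
    ENNReal.ofReal_mul (Real.rpow_nonneg hc r)]

lemma optErr_map (e : ℝ ≃ₜ ℝ) {c : ℝ} (hc : 0 < c)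
    (he : ∀ x y, |e x - e y| = c * |x - y|) (r : ℝ) (α : EReal) (μ : Measure ℝ) (R : ℝ) :
    optErr r α (μ.map e) R = ENNReal.ofReal (c ^ r) * optErr r α μ R := by
  have h0 : ENNReal.ofReal (c ^ r) ≠ 0 := by simpa using Real.rpow_pos_of_pos hc r
  unfold optErr
  rw [← (conjHomeo e).surjective.iInf_comp]
  simp only [isQuantizer_conjHomeo_iff, renyiEntropy_map_conjHomeo,
    distortion_map_conjHomeo e hc.le he, ENNReal.mul_iInf_of_ne h0 ENNReal.ofReal_ne_top]

lemma exists_homeomorph_of_similarity {T : ℝ → ℝ} (hT : Function.Bijective T) {c : ℝ}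
    (hc : 0 < c) (h : ∀ x y, |T x - T y| = c * |x - y|) : ∃ e : ℝ ≃ₜ ℝ, ⇑e = T := by
  have hT' : LipschitzWith c.toNNReal T := LipschitzWith.of_dist_le_mul fun x y => by
    rw [Real.coe_toNNReal _ hc.le, Real.dist_eq, Real.dist_eq, h]
  have hA : AntilipschitzWith c⁻¹.toNNReal T := AntilipschitzWith.of_le_mul_dist fun x y => by
    rw [Real.coe_toNNReal _ (inv_pos.2 hc).le, Real.dist_eq, Real.dist_eq, h,
      inv_mul_cancel_left₀ hc.ne']
  exact ⟨(Equiv.ofBijective T hT).toHomeomorphOfIsInducing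
    (hA.isUniformInducing hT'.uniformContinuous).isInducing, rfl⟩

/-- behaviour of the optimal error and of optimal quantizers under
similarity transformations. -/
theorem statement14
    (r : ℝ) (hr : 0 < r) (α : EReal)
    (μ : Measure ℝ) [IsProbabilityMeasure μ]
    (T : ℝ → ℝ) (hT : Function.Bijective T)
    (cs : ℝ) (hcs : 0 < cs) (hsim : ∀ x y : ℝ, |T x - T y| = cs * |x - y|)
    (R : ℝ) (hR : 0 ≤ R) :
    optErr r α (μ.map T) R = ENNReal.ofReal (cs ^ r) * optErr r α μ R ∧
    {q : ℝ → ℝ | Qc q ∧ distortion r (μ.map T) q = optErr r α (μ.map T) R} =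
      (fun q : ℝ → ℝ => T ∘ q ∘ Function.invFun T) ''
        {q : ℝ → ℝ | Qc q ∧ distortion r μ q = optErr r α μ R} := by
  obtain ⟨e, rfl⟩ := exists_homeomorph_of_similarity hT hcs hsim
  have hopt := optErr_map e hcs hsim r α μ R
  refine ⟨hopt, ?_⟩
  have hinv : Function.invFun e = e.symm :=
    funext fun x => e.injective <| by
      rw [Function.rightInverse_invFun e.surjective x, e.apply_symm_apply]
  have h0 : ENNReal.ofReal (cs ^ r) ≠ 0 := by simpa using Real.rpow_pos_of_pos hcs r
  rw [hinv]
  change _ = conjHomeo e '' _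
  ext p
  obtain ⟨q, rfl⟩ := (conjHomeo e).surjective p
  rw [(conjHomeo e).injective.mem_set_image, mem_ofPred_eq, mem_ofPred_eq, qc_conjHomeo_iff, hopt,
    distortion_map_conjHomeo e hcs.le hsim, ENNReal.mul_right_inj h0 ENNReal.ofReal_ne_top]

end
end

section
/- Let r ≥ 1, R ≥ 0, α ∈ [0, ∞) with α ≠ 1, and m ≥ 2. Let μ be a Borel probability measure on ℝ that is m-divisible with respect to pairwise disjoint measurable sets (A₁,…,A_m), set s_i = μ(A_i) and μ_i = μ(·|A_i), and assume ∫|x|^r dμ_i(x) < ∞ for every i. Let R₁,…,R_m ∈ [0, ∞). If log(∑_{i=1}^m s_i^α·e^{(1−α)R_i}) ≤ (1−α)·R in case α ∈ [0,1), or log(∑_{i=1}^m s_i^α·e^{(1−α)R_i}) ≥ (1−α)·R in case α ∈ (1,∞), then D^α_μ(R) ≤ ∑_{i=1}^m s_i·D^α_{μ_i}(R_i). -/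
open MeasureTheory Filter Set
open scoped ENNReal Topology Classical

noncomputable section

/-- The contribution `t ^ α` of a cell of mass `t` to the Rényi power sum; null cells contribute `0`. -/
def cellPow (α : ℝ) (t : ℝ≥0∞) : ℝ≥0∞ := if 0 < t then t ^ α else 0

lemma cellPow_zero (α : ℝ) : cellPow α 0 = 0 := by simp [cellPow]

lemma cellPow_of_pos {α : ℝ} (hα : 0 < α) (t : ℝ≥0∞) : cellPow α t = t ^ α := by
  rcases eq_or_ne t 0 with rfl | ht
  · simp [cellPow, hα]
  · simp [cellPow, pos_iff_ne_zero.2 ht]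

lemma cellPow_add_le {α : ℝ} (h0 : 0 ≤ α) (h1 : α ≤ 1) (x y : ℝ≥0∞) :
    cellPow α (x + y) ≤ cellPow α x + cellPow α y := by
  rcases eq_or_ne x 0 with rfl | hx
  · simp [cellPow_zero]
  rcases eq_or_ne y 0 with rfl | hy
  · simp [cellPow_zero]
  have hxy : 0 < x + y := (pos_iff_ne_zero.2 hx).trans_le le_self_add
  simpa only [cellPow, hxy, pos_iff_ne_zero.2 hx, pos_iff_ne_zero.2 hy, if_true] using
    ENNReal.rpow_add_le_add_rpow x y h0 h1

lemma cellPow_sum_le {ι : Type*} {α : ℝ} (h0 : 0 ≤ α) (h1 : α ≤ 1) (s : Finset ι)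
    (f : ι → ℝ≥0∞) : cellPow α (∑ i ∈ s, f i) ≤ ∑ i ∈ s, cellPow α (f i) :=
  Finset.le_sum_of_subadditive (cellPow α) (cellPow_zero α).le (cellPow_add_le h0 h1) s f

lemma sum_cellPow_le {ι : Type*} {α : ℝ} (h1 : 1 ≤ α) (s : Finset ι) (f : ι → ℝ≥0∞) :
    ∑ i ∈ s, cellPow α (f i) ≤ cellPow α (∑ i ∈ s, f i) := by
  have h0 : 0 < α := one_pos.trans_le h1
  induction s using Finset.induction_on with
  | empty => simp
  | insert a s ha ih =>
    rw [Finset.sum_insert ha, Finset.sum_insert ha]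
    refine (add_le_add_right ih _).trans ?_
    simp only [cellPow_of_pos h0]
    exact ENNReal.add_rpow_le_rpow_add _ _ h1

lemma cellPow_mul {α : ℝ} (h0 : 0 ≤ α) {c : ℝ≥0∞} (hc : c ≠ 0) (t : ℝ≥0∞) :
    cellPow α (c * t) = c ^ α * cellPow α t := by
  rcases eq_or_ne t 0 with rfl | ht
  · simp [cellPow_zero]
  have h : 0 < c * t := pos_iff_ne_zero.2 (mul_ne_zero hc ht)
  simp only [cellPow, h, pos_iff_ne_zero.2 ht, if_true]
  exact ENNReal.mul_rpow_of_nonneg _ _ h0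

lemma renyiEntropy_eq {α : ℝ} (hα1 : α ≠ 1) (μ : Measure ℝ) (q : ℝ → ℝ) :
    renyiEntropy (α : EReal) μ q =
      (((1 - α)⁻¹ : ℝ) : EReal) * ENNReal.log (∑' a : ℝ, cellPow α (μ (q ⁻¹' {a}))) := by
  have h1 : (α : EReal) ≠ 1 := by exact_mod_cast hα1
  simp [renyiEntropy, h1, cellPow]

lemma ennreal_log_ofReal_exp (x : ℝ) : ENNReal.log (ENNReal.ofReal (Real.exp x)) = (x : EReal) := by
  rw [ENNReal.log_ofReal_of_pos (Real.exp_pos x), Real.log_exp]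

lemma renyiEntropy_le_iff_of_lt_one {α : ℝ} (h : α < 1) (μ : Measure ℝ) (q : ℝ → ℝ) (R : ℝ) :
    renyiEntropy (α : EReal) μ q ≤ (R : EReal) ↔
      ∑' a : ℝ, cellPow α (μ (q ⁻¹' {a})) ≤ ENNReal.ofReal (Real.exp ((1 - α) * R)) := by
  have hp : 0 < 1 - α := sub_pos.2 h
  rw [renyiEntropy_eq h.ne, ← ENNReal.log_le_log_iff, ennreal_log_ofReal_exp]
  induction ENNReal.log (∑' a : ℝ, cellPow α (μ (q ⁻¹' {a}))) with
  | bot => simp [EReal.coe_mul_bot_of_pos (inv_pos.2 hp)]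
  | top =>
    rw [EReal.coe_mul_top_of_pos (inv_pos.2 hp)]
    simp only [top_le_iff, EReal.coe_ne_top]
  | coe x =>
    rw [← EReal.coe_mul, EReal.coe_le_coe_iff, EReal.coe_le_coe_iff, inv_mul_le_iff₀ hp]

lemma renyiEntropy_le_iff_of_one_lt {α : ℝ} (h : 1 < α) (μ : Measure ℝ) (q : ℝ → ℝ) (R : ℝ) :
    renyiEntropy (α : EReal) μ q ≤ (R : EReal) ↔
      ENNReal.ofReal (Real.exp ((1 - α) * R)) ≤ ∑' a : ℝ, cellPow α (μ (q ⁻¹' {a})) := by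
  have hn : 1 - α < 0 := sub_neg.2 h
  rw [renyiEntropy_eq h.ne', ← ENNReal.log_le_log_iff, ennreal_log_ofReal_exp]
  induction ENNReal.log (∑' a : ℝ, cellPow α (μ (q ⁻¹' {a}))) with
  | bot =>
    rw [EReal.coe_mul_bot_of_neg (inv_lt_zero.2 hn)]
    simp only [top_le_iff, le_bot_iff, EReal.coe_ne_top, EReal.coe_ne_bot]
  | top => simp [EReal.coe_mul_top_of_neg (inv_lt_zero.2 hn)]
  | coe x =>
    rw [← EReal.coe_mul, EReal.coe_le_coe_iff, EReal.coe_le_coe_iff, inv_mul_eq_div,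
      div_le_iff_of_neg hn, mul_comm]

section Gluing

variable {m : ℕ} {A : Fin m → Set ℝ}

/-- The quantizer that equals `q i` on `A i` and vanishes off `⋃ i, A i`. -/
def glue (A : Fin m → Set ℝ) (q : Fin m → ℝ → ℝ) (x : ℝ) : ℝ :=
  ∑ i, (A i).indicator (q i) x

lemma glue_of_mem (hdisj : Pairwise (Function.onFun Disjoint A)) (q : Fin m → ℝ → ℝ)
    {i : Fin m} {x : ℝ} (hx : x ∈ A i) : glue A q x = q i x := by
  rw [glue, Finset.sum_eq_single i]
  · exact indicator_of_mem hx _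
  · intro j _ hj
    exact indicator_of_notMem (fun h => Set.disjoint_left.1 (hdisj hj) h hx) _
  · simp

lemma isQuantizer_glue (hA : ∀ i, MeasurableSet (A i))
    (hdisj : Pairwise (Function.onFun Disjoint A)) {q : Fin m → ℝ → ℝ}
    (hq : ∀ i, IsQuantizer (q i)) : IsQuantizer (glue A q) := by
  refine ⟨Finset.measurable_fun_sum _ fun i _ => (hq i).1.indicator (hA i), ?_⟩
  refine ((countable_iUnion fun i => (hq i).2).insert 0).mono ?_
  rintro _ ⟨x, rfl⟩
  by_cases hx : ∃ i, x ∈ A i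
  · obtain ⟨i, hi⟩ := hx
    exact Or.inr (mem_iUnion.2 ⟨i, x, (glue_of_mem hdisj q hi).symm⟩)
  · refine Or.inl (Finset.sum_eq_zero fun i _ => indicator_of_notMem (fun h => hx ⟨i, h⟩) _)

lemma tsum_sum_cellPow {μ : Measure ℝ} {α : ℝ} (h0 : 0 ≤ α) (hpos : ∀ i, 0 < μ (A i)) (q : Fin m → ℝ → ℝ) :
    ∑' a : ℝ, ∑ i, cellPow α (μ (A i) * ((μ (A i))⁻¹ • μ.restrict (A i)) (q i ⁻¹' {a})) =
      ∑ i, μ (A i) ^ α *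
        ∑' a : ℝ, cellPow α (((μ (A i))⁻¹ • μ.restrict (A i)) (q i ⁻¹' {a})) := by
  rw [Summable.tsum_finsetSum fun _ _ => ENNReal.summable]
  refine Finset.sum_congr rfl fun i _ => ?_
  simp_rw [cellPow_mul h0 (hpos i).ne', ENNReal.tsum_mul_left]

variable {μ : Measure ℝ} [IsProbabilityMeasure μ]

lemma eq_sum_restrict (hA : ∀ i, MeasurableSet (A i))
    (hdisj : Pairwise (Function.onFun Disjoint A)) (hcover : μ (⋃ i, A i) = 1) :
    μ = ∑ i, μ.restrict (A i) := by
  rw [← Measure.sum_fintype, ← Measure.restrict_iUnion hdisj hA, eq_comm]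
  refine Measure.restrict_eq_self_of_ae_mem ?_
  exact (prob_compl_eq_zero_iff (MeasurableSet.iUnion hA)).2 hcover

lemma measure_mul_cond_apply (hpos : ∀ i, 0 < μ (A i)) (i : Fin m) (s : Set ℝ) :
    μ (A i) * ((μ (A i))⁻¹ • μ.restrict (A i)) s = μ.restrict (A i) s := by
  rw [Measure.smul_apply, smul_eq_mul, ← mul_assoc,
    ENNReal.mul_inv_cancel (hpos i).ne' (measure_ne_top _ _), one_mul]

lemma measure_glue_preimage (hA : ∀ i, MeasurableSet (A i))
    (hdisj : Pairwise (Function.onFun Disjoint A)) (hpos : ∀ i, 0 < μ (A i))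
    (hcover : μ (⋃ i, A i) = 1) (q : Fin m → ℝ → ℝ) (a : ℝ) :
    μ (glue A q ⁻¹' {a}) =
      ∑ i, μ (A i) * ((μ (A i))⁻¹ • μ.restrict (A i)) (q i ⁻¹' {a}) := by
  conv_lhs => rw [eq_sum_restrict hA hdisj hcover]
  rw [Measure.finsetSum_apply]
  refine Finset.sum_congr rfl fun i _ => ?_
  rw [measure_mul_cond_apply hpos, Measure.restrict_apply' (hA i), Measure.restrict_apply' (hA i)]
  congr 1
  ext x
  refine and_congr_left fun hx => ?_
  simp [glue_of_mem hdisj q hx]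

lemma distortion_glue (r : ℝ) (hA : ∀ i, MeasurableSet (A i))
    (hdisj : Pairwise (Function.onFun Disjoint A)) (hpos : ∀ i, 0 < μ (A i))
    (hcover : μ (⋃ i, A i) = 1) (q : Fin m → ℝ → ℝ) :
    distortion r μ (glue A q) =
      ∑ i, μ (A i) * distortion r ((μ (A i))⁻¹ • μ.restrict (A i)) (q i) := by
  unfold distortion
  conv_lhs => rw [eq_sum_restrict hA hdisj hcover]
  rw [lintegral_finsetSum_measure]
  refine Finset.sum_congr rfl fun i _ => ?_
  rw [lintegral_smul_measure, smul_eq_mul, ← mul_assoc,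
    ENNReal.mul_inv_cancel (hpos i).ne' (measure_ne_top _ _), one_mul]
  exact setLIntegral_congr_fun (hA i) fun x hx => by simp only [glue_of_mem hdisj q hx]

lemma sum_rpow_mul_ofReal_exp {α : ℝ} (h0 : 0 ≤ α) (x : Fin m → ℝ) :
    ∑ i, μ (A i) ^ α * ENNReal.ofReal (Real.exp (x i)) =
      ENNReal.ofReal (∑ i, (μ (A i)).toReal ^ α * Real.exp (x i)) := by
  rw [ENNReal.ofReal_sum_of_nonneg fun i _ => by positivity]
  refine Finset.sum_congr rfl fun i _ => ?_
  rw [ENNReal.ofReal_mul (by positivity), ← ENNReal.ofReal_rpow_of_nonneg ENNReal.toReal_nonneg h0,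
    ENNReal.ofReal_toReal (measure_ne_top _ _)]

lemma renyiEntropy_glue_le {α R : ℝ} (hα : 0 ≤ α) (hm : 0 < m) (hA : ∀ i, MeasurableSet (A i))
    (hdisj : Pairwise (Function.onFun Disjoint A)) (hpos : ∀ i, 0 < μ (A i))
    (hcover : μ (⋃ i, A i) = 1) (Rv : Fin m → ℝ)
    (hcond :
      (α < 1 ∧
        Real.log (∑ i, (μ (A i)).toReal ^ α * Real.exp ((1 - α) * Rv i)) ≤ (1 - α) * R) ∨
      (1 < α ∧
        (1 - α) * R ≤ Real.log (∑ i, (μ (A i)).toReal ^ α * Real.exp ((1 - α) * Rv i))))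
    {q : Fin m → ℝ → ℝ}
    (hq : ∀ i, renyiEntropy (α : EReal) ((μ (A i))⁻¹ • μ.restrict (A i)) (q i) ≤ (Rv i : EReal)) :
    renyiEntropy (α : EReal) μ (glue A q) ≤ (R : EReal) := by
  have hS : 0 < ∑ i, (μ (A i)).toReal ^ α * Real.exp ((1 - α) * Rv i) :=
    Finset.sum_pos (fun i _ => mul_pos
      (Real.rpow_pos_of_pos (ENNReal.toReal_pos (hpos i).ne' (measure_ne_top _ _)) _)
      (Real.exp_pos _)) ⟨⟨0, hm⟩, Finset.mem_univ _⟩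
  rcases hcond with ⟨h1, hc⟩ | ⟨h1, hc⟩
  · rw [renyiEntropy_le_iff_of_lt_one h1]
    calc ∑' a : ℝ, cellPow α (μ (glue A q ⁻¹' {a}))
        ≤ ∑' a : ℝ, ∑ i,
            cellPow α (μ (A i) * ((μ (A i))⁻¹ • μ.restrict (A i)) (q i ⁻¹' {a})) := by
          refine ENNReal.tsum_le_tsum fun a => ?_
          rw [measure_glue_preimage hA hdisj hpos hcover]
          exact cellPow_sum_le hα h1.le _ _
      _ = _ := tsum_sum_cellPow hα hpos q
      _ ≤ ∑ i, μ (A i) ^ α * ENNReal.ofReal (Real.exp ((1 - α) * Rv i)) := by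
          gcongr with i
          exact (renyiEntropy_le_iff_of_lt_one h1 _ _ _).1 (hq i)
      _ = _ := sum_rpow_mul_ofReal_exp hα _
      _ ≤ _ := ENNReal.ofReal_le_ofReal ((Real.log_le_iff_le_exp hS).1 hc)
  · rw [renyiEntropy_le_iff_of_one_lt h1]
    calc ENNReal.ofReal (Real.exp ((1 - α) * R))
        ≤ ENNReal.ofReal (∑ i, (μ (A i)).toReal ^ α * Real.exp ((1 - α) * Rv i)) :=
          ENNReal.ofReal_le_ofReal ((Real.le_log_iff_exp_le hS).1 hc)
      _ = ∑ i, μ (A i) ^ α * ENNReal.ofReal (Real.exp ((1 - α) * Rv i)) :=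
          (sum_rpow_mul_ofReal_exp hα _).symm
      _ ≤ _ := by
          gcongr with i
          exact (renyiEntropy_le_iff_of_one_lt h1 _ _ _).1 (hq i)
      _ = _ := (tsum_sum_cellPow hα hpos q).symm
      _ ≤ ∑' a : ℝ, cellPow α (μ (glue A q ⁻¹' {a})) := by
          refine ENNReal.tsum_le_tsum fun a => ?_
          rw [measure_glue_preimage hA hdisj hpos hcover]
          exact sum_cellPow_le h1.le _ _

end Gluing

lemma exists_distortion_lt_of_optErr_lt {r R : ℝ} {α : EReal} {μ : Measure ℝ} {b : ℝ≥0∞}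
    (h : optErr r α μ R < b) :
    ∃ q, IsQuantizer q ∧ renyiEntropy α μ q ≤ (R : EReal) ∧ distortion r μ q < b := by
  simpa only [optErr, iInf_lt_iff, exists_prop, and_assoc] using h

/-- upper bound for the optimal error of mixture distributions. -/
theorem statement15
    (r : ℝ) (hr : 1 ≤ r) (R : ℝ) (hR : 0 ≤ R)
    (α : ℝ) (hα : 0 ≤ α) (hα1 : α ≠ 1)
    (m : ℕ) (hm : 2 ≤ m)
    (μ : Measure ℝ) [IsProbabilityMeasure μ]
    (A : Fin m → Set ℝ) (hAmeas : ∀ i, MeasurableSet (A i))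
    (hdisj : Pairwise (Function.onFun Disjoint A))
    (hpos : ∀ i, 0 < μ (A i)) (hcover : μ (⋃ i, A i) = 1)
    (hmom : ∀ i, Integrable (fun x => |x| ^ r) ((μ (A i))⁻¹ • μ.restrict (A i)))
    (Rv : Fin m → ℝ) (hRv : ∀ i, 0 ≤ Rv i)
    (hcond :
      (α < 1 ∧
        Real.log (∑ i, (μ (A i)).toReal ^ α * Real.exp ((1 - α) * Rv i)) ≤ (1 - α) * R) ∨
      (1 < α ∧
        (1 - α) * R ≤ Real.log (∑ i, (μ (A i)).toReal ^ α * Real.exp ((1 - α) * Rv i)))) :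
    optErr r (α : EReal) μ R ≤
      ∑ i, μ (A i) * optErr r (α : EReal) ((μ (A i))⁻¹ • μ.restrict (A i)) (Rv i) := by
  refine ENNReal.le_of_forall_pos_le_add fun ε hε hfin => ?_
  have hlt : ∀ i, optErr r (α : EReal) ((μ (A i))⁻¹ • μ.restrict (A i)) (Rv i) <
      optErr r (α : EReal) ((μ (A i))⁻¹ • μ.restrict (A i)) (Rv i) + ε := by
    intro i
    refine ENNReal.lt_add_right (fun htop => ?_) (by exact_mod_cast hε.ne')
    have hi := ENNReal.sum_lt_top.1 hfin i (Finset.mem_univ i)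
    rw [htop, ENNReal.mul_top (hpos i).ne'] at hi
    exact hi.ne rfl
  choose q hq hH hD using fun i => exists_distortion_lt_of_optErr_lt (hlt i)
  have hsum : ∑ i, μ (A i) = 1 := by
    rw [← hcover, measure_iUnion hdisj hAmeas, tsum_fintype]
  calc optErr r (α : EReal) μ R
      ≤ distortion r μ (glue A q) :=
        iInf₂_le _ ⟨isQuantizer_glue hAmeas hdisj hq,
          renyiEntropy_glue_le hα (by omega) hAmeas hdisj hpos hcover Rv hcond hH⟩
    _ = ∑ i, μ (A i) * distortion r ((μ (A i))⁻¹ • μ.restrict (A i)) (q i) :=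
        distortion_glue r hAmeas hdisj hpos hcover q
    _ ≤ ∑ i, μ (A i) *
          (optErr r (α : EReal) ((μ (A i))⁻¹ • μ.restrict (A i)) (Rv i) + ε) := by
        gcongr with i
        exact (hD i).le
    _ = _ := by
        simp_rw [mul_add]
        rw [Finset.sum_add_distrib, ← Finset.sum_mul, hsum, one_mul]

end
end

section
/- Let r ≥ 1, α ∈ [0,1), and m ≥ 2. Let μ be a nonatomic Borel probability measure on ℝ that is m-divisible with respect to pairwise disjoint measurable sets (A₁,…,A_m), with μ_i = μ(·|A_i) and ∫|x|^r dμ_i(x) < ∞ for all i. Let i₀ be an index with μ(A_{i₀}) = s = max{μ(A_i) : 1 ≤ i ≤ m}. Then liminf_{R→∞} e^{rR}·D^α_μ(R) ≥ s^{a₁·a₂}·liminf_{R→∞} e^{rR}·D^α_{μ_{i₀}}(R). -/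
open MeasureTheory Filter Set
open scoped ENNReal Topology Classical

noncomputable section

/-- Conditioning on `A` changes the Rényi entropy of order `α ∈ [0,1)` by at most
`-(α/(1-α))·log μ(A)` upwards. -/
lemma renyiEntropy_cond_le {α : ℝ} (hα : α ∈ Set.Ico (0 : ℝ) 1) {μ : Measure ℝ}
    [IsFiniteMeasure μ] {A : Set ℝ} (hA : 0 < μ A) {q : ℝ → ℝ} {R : ℝ}
    (h : renyiEntropy α μ q ≤ R) :
    renyiEntropy α ((μ A)⁻¹ • μ.restrict A) q ≤
      ((R + -(α / (1 - α) * Real.log (μ A).toReal) : ℝ) : EReal) := by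
  have hα1 : ((α : ℝ) : EReal) ≠ 1 := by exact_mod_cast hα.2.ne
  have hc : 0 ≤ (1 - α)⁻¹ := inv_nonneg.2 (by linarith [hα.2])
  have hfin : μ A ≠ ∞ := measure_ne_top μ A
  simp only [renyiEntropy, EReal.coe_ne_top, EReal.coe_ne_bot, hα1, if_false,
    EReal.toReal_coe] at h ⊢
  have hsum : (∑' a : ℝ, if 0 < ((μ A)⁻¹ • μ.restrict A) (q ⁻¹' {a}) then
        ((μ A)⁻¹ • μ.restrict A) (q ⁻¹' {a}) ^ α else 0) ≤
      (μ A)⁻¹ ^ α * ∑' a : ℝ, if 0 < μ (q ⁻¹' {a}) then μ (q ⁻¹' {a}) ^ α else 0 := by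
    rw [← ENNReal.tsum_mul_left]
    refine ENNReal.tsum_le_tsum fun a => ?_
    have hle : μ.restrict A (q ⁻¹' {a}) ≤ μ (q ⁻¹' {a}) := Measure.restrict_apply_le _ _
    rw [Measure.smul_apply, smul_eq_mul]
    split_ifs with h₁ h₂
    · rw [ENNReal.mul_rpow_of_nonneg _ _ hα.1]
      gcongr
      exact hα.1
    · exact absurd ((pos_of_ne_zero (right_ne_zero_of_mul h₁.ne')).trans_le hle) h₂
    · exact zero_le
    · exact zero_le
  have hlog : ENNReal.log ((μ A)⁻¹ ^ α) = ((-(α * Real.log (μ A).toReal) : ℝ) : EReal) := by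
    rw [ENNReal.log_rpow, ENNReal.log_inv, ENNReal.log_pos_real hA.ne' hfin]
    norm_cast
    ring
  have hcoe : (0 : EReal) ≤ (((1 - α)⁻¹ : ℝ) : EReal) := by exact_mod_cast hc
  calc _ ≤ (((1 - α)⁻¹ : ℝ) : EReal) * ENNReal.log ((μ A)⁻¹ ^ α *
          ∑' a : ℝ, if 0 < μ (q ⁻¹' {a}) then μ (q ⁻¹' {a}) ^ α else 0) :=
        mul_le_mul_of_nonneg_left (ENNReal.log_monotone hsum) hcoe
    _ = (((1 - α)⁻¹ * -(α * Real.log (μ A).toReal) : ℝ) : EReal) +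
          (((1 - α)⁻¹ : ℝ) : EReal) * ENNReal.log
            (∑' a : ℝ, if 0 < μ (q ⁻¹' {a}) then μ (q ⁻¹' {a}) ^ α else 0) := by
        rw [ENNReal.log_mul_add, hlog,
          EReal.left_distrib_of_nonneg_of_ne_top hcoe (EReal.coe_ne_top _), EReal.coe_mul]
    _ ≤ (((1 - α)⁻¹ * -(α * Real.log (μ A).toReal) : ℝ) : EReal) + R := by gcongr
    _ = _ := by
        rw [← EReal.coe_add]
        congr 1
        ring

/-- The optimal error of `μ` dominates the weighted optimal error of its conditional
probability on `A`, at a shifted rate. -/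
lemma mul_optErr_cond_le {r α : ℝ} (hα : α ∈ Set.Ico (0 : ℝ) 1) {μ : Measure ℝ}
    [IsFiniteMeasure μ] {A : Set ℝ} (hA : 0 < μ A) (R : ℝ) :
    μ A * optErr r α ((μ A)⁻¹ • μ.restrict A)
        (R + -(α / (1 - α) * Real.log (μ A).toReal)) ≤ optErr r α μ R := by
  refine le_iInf₂ fun q hq => ?_
  calc _ ≤ μ A * distortion r ((μ A)⁻¹ • μ.restrict A) q := by
        gcongr
        exact iInf₂_le q ⟨hq.1, renyiEntropy_cond_le hα hA hq.2⟩
    _ = ∫⁻ x in A, ENNReal.ofReal (|x - q x| ^ r) ∂μ := by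
        rw [distortion, lintegral_smul_measure, smul_eq_mul, ← mul_assoc,
          ENNReal.mul_inv_cancel hA.ne' (measure_ne_top μ A), one_mul]
    _ ≤ distortion r μ q := setLIntegral_le_lintegral _ _

/-- liminf lower bound for mixtures in terms of the heaviest component. -/
theorem statement16
    (r : ℝ) (hr : 1 ≤ r) (α : ℝ) (hα : α ∈ Set.Ico (0 : ℝ) 1)
    (m : ℕ) (hm : 2 ≤ m)
    (μ : Measure ℝ) [IsProbabilityMeasure μ]
    (hna : ∀ x : ℝ, μ {x} = 0)
    (A : Fin m → Set ℝ) (hAmeas : ∀ i, MeasurableSet (A i))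
    (hdisj : Pairwise (Function.onFun Disjoint A))
    (hpos : ∀ i, 0 < μ (A i)) (hcover : μ (⋃ i, A i) = 1)
    (hmom : ∀ i, Integrable (fun x => |x| ^ r) ((μ (A i))⁻¹ • μ.restrict (A i)))
    (i₀ : Fin m) (hi₀ : ∀ i, μ (A i) ≤ μ (A i₀)) :
    ENNReal.ofReal ((μ (A i₀)).toReal ^ (a1 α r * a2 α r)) *
        Filter.liminf
          (fun R : ℝ => ENNReal.ofReal (Real.exp (r * R)) *
            optErr r (α : EReal) ((μ (A i₀))⁻¹ • μ.restrict (A i₀)) R) atTop ≤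
      Filter.liminf
        (fun R : ℝ => ENNReal.ofReal (Real.exp (r * R)) * optErr r (α : EReal) μ R) atTop := by
  set s := (μ (A i₀)).toReal with hs
  have hfin : μ (A i₀) ≠ ∞ := measure_ne_top μ _
  have hs0 : 0 < s := ENNReal.toReal_pos (hpos i₀).ne' hfin
  have h1 : 0 < 1 - α := by linarith [hα.2]
  set c := -(α / (1 - α) * Real.log s) with hc
  rw [← ENNReal.liminf_const_mul_of_ne_top ENNReal.ofReal_ne_top]
  refine (Tendsto.liminf_le_liminf_comp (tendsto_atTop_add_const_right atTop c tendsto_id)).trans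
    (liminf_le_liminf (Eventually.of_forall fun R => ?_))
  have hexp : s ^ (a1 α r * a2 α r) * Real.exp (r * (R + c)) = Real.exp (r * R) * s := by
    have ha : a1 α r * a2 α r = 1 + r * (α / (1 - α)) := by
      have h2 : 1 - α + r ≠ 0 := by linarith
      rw [a1, a2]
      field_simp
    nth_rw 2 [← Real.exp_log hs0]
    rw [ha, Real.rpow_def_of_pos hs0, ← Real.exp_add, ← Real.exp_add]
    congr 1
    rw [hc]
    ring
  simp only [Function.comp_apply, id_eq]
  rw [← mul_assoc, ← ENNReal.ofReal_mul (by positivity), hexp,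
    ENNReal.ofReal_mul (by positivity), hs, ENNReal.ofReal_toReal hfin, mul_assoc]
  gcongr
  exact mul_optErr_cond_le hα (hpos i₀) R

end
end
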